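/- No wandering domains for polynomials (Sullivan): let f be a complex polynomial of degree d ≥ 2 and let K = {z ∈ ℂ : the orbit of z under f is bounded} be its filled Julia set. Then every connected component of the interior of K is eventually periodic: for every z in the interior of K there exist integers 0 ≤ n < m such that f^n(z) and f^m(z) lie in the same connected component of the interior of K. -/

import Mathlib

namespace NWD

/-- Product of edge labels along a list of vertices. -/
def hol {α G : Type*} [Group G] (g : α → α → G) : List α → G
  | [] => 1
  | [_] => 1
  | a :: b :: t => g a b * hol g (b :: t)

lemma hol_split {α G : Type*} [Group G] (g : α → α → G) (l₁ : List α) (c : α) (l₂ : List α) :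
    hol g (l₁ ++ c :: l₂) = hol g (l₁ ++ [c]) * hol g (c :: l₂) := by
  induction l₁ with
  | nil => simp [hol]
  | cons a t ih =>
    cases t with
    | nil => simp [hol]
    | cons b t => simp only [List.cons_append, hol] at ih ⊢; rw [ih, mul_assoc]

theorem hol_grid_eq_one {G : Type*} [Group G] (g : ℤ × ℤ → ℤ × ℤ → G)
    (Adj : ℤ × ℤ → ℤ × ℤ → Prop) (B : ℤ)
    (hnb : ∀ u v, Adj u v → u.1 + u.2 ≤ v.1 + v.2 →
      u = (v.1 - 1, v.2) ∨ u = (v.1, v.2 - 1))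
    (hsymm : ∀ u v, Adj u v → Adj v u)
    (hinv : ∀ u v, Adj u v → g u v * g v u = 1)
    (hB : ∀ u v, Adj u v → 0 ≤ u.1 + u.2 + B)
    (hfull : ∀ (v : ℤ × ℤ) (x y : ℤ × ℤ) (l : List (ℤ × ℤ)),
      List.IsChain Adj (v :: x :: (l ++ [y, v])) → v ∉ x :: (l ++ [y]) →
      (∀ w ∈ x :: (l ++ [y]), w.1 + w.2 ≤ v.1 + v.2) →
      ((x = (v.1 - 1, v.2) ∧ y = (v.1, v.2 - 1)) ∨ (y = (v.1 - 1, v.2) ∧ x = (v.1, v.2 - 1))) →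
      Adj (v.1 - 1, v.2 - 1) x ∧ Adj y (v.1 - 1, v.2 - 1) ∧
      g y v * g v x = g y (v.1 - 1, v.2 - 1) * g (v.1 - 1, v.2 - 1) x) :
    ∀ (v : ℤ × ℤ) (l : List (ℤ × ℤ)), List.IsChain Adj (v :: (l ++ [v])) →
      hol g (v :: (l ++ [v])) = 1 := by
  suffices H : ∀ n : ℕ, ∀ M : ℕ, ∀ (v : ℤ × ℤ) (l : List (ℤ × ℤ)), l.length = n →
      ((v :: l).map fun w => (w.1 + w.2 + B).toNat).sum = M →
      List.IsChain Adj (v :: (l ++ [v])) → hol g (v :: (l ++ [v])) = 1 by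
    intro v l h; exact H _ _ v l rfl rfl h
  intro n
  induction n using Nat.strong_induction_on with
  | _ n ihn =>
  have ihn' : ∀ v l, List.length l < n → List.IsChain Adj (v :: (l ++ [v])) →
      hol g (v :: (l ++ [v])) = 1 := fun v l h h' => ihn _ h _ v l rfl rfl h'
  intro M
  induction M using Nat.strong_induction_on with
  | _ M ihM =>
  -- case of a maximal base vertex
  have key : ∀ (v : ℤ × ℤ) (l : List (ℤ × ℤ)), l.length = n →
      ((v :: l).map fun w => (w.1 + w.2 + B).toNat).sum = M →
      (∀ w ∈ l, w.1 + w.2 ≤ v.1 + v.2) →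
      List.IsChain Adj (v :: (l ++ [v])) → hol g (v :: (l ++ [v])) = 1 := by
    intro v l hl hM hmax hch
    by_cases hv : v ∈ l
    · obtain ⟨l₁, l₂, rfl⟩ := List.append_of_mem hv
      have e1 : v :: ((l₁ ++ v :: l₂) ++ [v]) = (v :: l₁) ++ v :: (l₂ ++ [v]) := by simp
      rw [e1] at hch ⊢
      rw [List.isChain_split] at hch
      rw [hol_split]
      simp only [List.length_append, List.length_cons] at hl
      have := ihn' v l₁ (by omega) (by simpa using hch.1)
      have h2 := ihn' v l₂ (by omega) hch.2
      rw [List.cons_append, this, h2, one_mul]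
    · cases l with
      | nil =>
        exfalso
        simp at hch
        have h1 := hnb _ _ hch le_rfl
        rcases h1 with h1 | h1
        · have := congrArg Prod.fst h1; simp at this; omega
        · have := congrArg Prod.snd h1; simp at this; omega
      | cons x t =>
        rcases List.eq_nil_or_concat t with rfl | ⟨l', y, rfl⟩
        · simp [hol] at hch ⊢
          exact hinv _ _ hch.1
        · have hc2 : List.IsChain Adj (v :: x :: (l' ++ [y, v])) := by simpa using hch
          have hyv : Adj y v := by
            have : v :: x :: (l' ++ [y, v]) = (v :: x :: l') ++ y :: [v] := by simp
            rw [this, List.isChain_split] at hc2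
            simpa using hc2.2
          have hvx : Adj v x := by rw [List.isChain_cons_cons] at hc2; exact hc2.1
          have hmid : List.IsChain Adj (x :: (l' ++ [y])) := by
            have : v :: x :: (l' ++ [y, v]) = (v :: x :: l') ++ y :: [v] := by simp
            rw [this, List.isChain_split] at hc2
            have h := hc2.1
            rw [List.cons_append, List.cons_append, List.isChain_cons_cons] at h
            exact h.2
          have hexp : hol g (v :: ((x :: (l' ++ [y])) ++ [v])) =
              g v x * hol g (x :: (l' ++ [y])) * g y v := by
            have : v :: ((x :: (l' ++ [y])) ++ [v]) = (v :: x :: l') ++ y :: [v] := by simp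
            rw [this, hol_split]
            simp [hol]
          have hx := hnb x v (hsymm _ _ hvx) (hmax x (by simp))
          have hy := hnb y v hyv (hmax y (by simp))
          by_cases hxy : x = y
          · subst hxy
            have := ihn' x l' (by simp at hl; omega) hmid
            simp only [List.concat_eq_append] at *
            rw [hexp, this, mul_one]
            exact hinv _ _ hvx
          · have hcase : (x = (v.1 - 1, v.2) ∧ y = (v.1, v.2 - 1)) ∨
                (y = (v.1 - 1, v.2) ∧ x = (v.1, v.2 - 1)) := by
              rcases hx with hx | hx <;> rcases hy with hy | hy
              · exact absurd (hx.trans hy.symm) hxy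
              · exact Or.inl ⟨hx, hy⟩
              · exact Or.inr ⟨hy, hx⟩
              · exact absurd (hx.trans hy.symm) hxy
            simp only [List.concat_eq_append] at *
            obtain ⟨hdx, hyd, hsq⟩ := hfull v x y l' hc2 hv hmax hcase
            set d : ℤ × ℤ := (v.1 - 1, v.2 - 1) with hd
            have hvB := hB v x hvx
            have hdB := hB d x hdx
            have hch' : List.IsChain Adj (d :: ((x :: (l' ++ [y])) ++ [d])) := by
              have : d :: ((x :: (l' ++ [y])) ++ [d]) = (d :: x :: l') ++ y :: [d] := by simp
              rw [this, List.isChain_split]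
              refine ⟨?_, by simpa using hyd⟩
              rw [List.cons_append, List.cons_append, List.isChain_cons_cons]
              exact ⟨hdx, hmid⟩
            have hrec := ihM ((((d :: (x :: (l' ++ [y]))).map fun w => (w.1 + w.2 + B).toNat)).sum)
              (by
                rw [← hM]
                simp only [List.map_cons, List.sum_cons]
                have : (d.1 + d.2 + B).toNat < (v.1 + v.2 + B).toNat := by
                  simp only [hd] at hdB ⊢
                  omega
                omega) d (x :: (l' ++ [y])) hl rfl hch'
            have hexp' : hol g (d :: ((x :: (l' ++ [y])) ++ [d])) =
              g d x * hol g (x :: (l' ++ [y])) * g y d := by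
              have : d :: ((x :: (l' ++ [y])) ++ [d]) = (d :: x :: l') ++ y :: [d] := by simp
              rw [this, hol_split]
              simp [hol]
            rw [hexp'] at hrec
            rw [hexp]
            generalize hol g (x :: (l' ++ [y])) = P at *
            -- g d x * P * g y d = 1, g y v * g v x = g y d * g d x
            have h1 : P = (g d x)⁻¹ * (g y d)⁻¹ := by
              have := hrec
              rw [mul_assoc, ← eq_inv_mul_iff_mul_eq, mul_one] at this
              exact eq_mul_inv_of_mul_eq this
            have h2 : P = (g v x)⁻¹ * (g y v)⁻¹ := by
              rw [h1, ← mul_inv_rev, ← mul_inv_rev, hsq]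
            rw [h2]; group
  intro v l hl hM hch
  obtain ⟨m, hm, hmax⟩ : ∃ m ∈ (v :: l), ∀ w ∈ (v :: l), w.1 + w.2 ≤ m.1 + m.2 := by
    have hne : (v :: l).toFinset.Nonempty := ⟨v, by simp⟩
    obtain ⟨m, hm, h⟩ := Finset.exists_max_image (v :: l).toFinset (fun w => w.1 + w.2) hne
    exact ⟨m, by simpa using hm, fun w hw => h w (by simpa using hw)⟩
  rcases List.mem_cons.1 hm with rfl | hm
  · exact key m l hl hM (fun w hw => hmax w (by simp [hw])) hch
  · obtain ⟨l₁, l₂, rfl⟩ := List.append_of_mem hm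
    have e1 : v :: ((l₁ ++ m :: l₂) ++ [v]) = (v :: l₁) ++ m :: (l₂ ++ [v]) := by simp
    have e2 : m :: ((l₂ ++ v :: l₁) ++ [m]) = (m :: l₂) ++ v :: (l₁ ++ [m]) := by simp
    rw [e1, List.isChain_split] at hch
    have h := key m (l₂ ++ v :: l₁) (by simp at hl ⊢; omega)
      (by rw [← hM]; simp; ring) (by
        intro w hw; apply hmax
        simp at hw ⊢; tauto) (by
        rw [e2, List.isChain_split]
        exact ⟨by simpa using hch.2, by simpa using hch.1⟩)
    rw [e2, hol_split] at h
    rw [e1, hol_split]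
    simp only [List.cons_append] at h ⊢
    exact mul_eq_one_comm.mp h
end NWD

namespace NWD
open Complex

/-- winding sum of a polygonal chain -/
noncomputable def wd (q : ℂ) : List ℂ → ℂ
  | [] => 0
  | [_] => 0
  | a :: b :: t => log ((b - q) / (a - q)) + wd q (b :: t)

/-- union of the segments of a chain -/
def trc : List ℂ → Set ℂ
  | [] => ∅
  | [a] => {a}
  | a :: b :: t => segment ℝ a b ∪ trc (b :: t)

lemma wd_split (q : ℂ) (l₁ : List ℂ) (c : ℂ) (l₂ : List ℂ) :
    wd q (l₁ ++ c :: l₂) = wd q (l₁ ++ [c]) + wd q (c :: l₂) := by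
  induction l₁ with
  | nil => simp [wd]
  | cons a t ih =>
    cases t with
    | nil => simp [wd]
    | cons b t => simp only [List.cons_append, wd] at ih ⊢; rw [ih, add_assoc]

lemma trc_split (l₁ : List ℂ) (c : ℂ) (l₂ : List ℂ) :
    trc (l₁ ++ c :: l₂) = trc (l₁ ++ [c]) ∪ trc (c :: l₂) := by
  induction l₁ with
  | nil =>
    cases l₂ with
    | nil => simp [trc]
    | cons b t => 
      simp only [List.nil_append, trc]
      rw [← Set.union_assoc]
      congr 1
      exact (Set.union_eq_self_of_subset_left (by simpa using left_mem_segment ℝ c b)).symm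
  | cons a t ih =>
    cases t with
    | nil =>
      simp only [List.cons_append, List.nil_append, trc] at ih ⊢
      cases l₂ with
      | nil => simp [trc]
      | cons b t => 
        rw [Set.union_assoc]
        congr 1
    | cons b t => simp only [List.cons_append, trc] at ih ⊢; rw [ih, Set.union_assoc]

lemma isCompact_trc : ∀ L, IsCompact (trc L)
  | [] => isCompact_empty
  | [a] => isCompact_singleton
  | a :: b :: t => by
    have : IsCompact (segment ℝ a b) := by
      rw [segment_eq_image_lineMap]
      exact isCompact_Icc.image (by fun_prop)
    exact this.union (isCompact_trc (b :: t))

lemma ratio_slit {q a b : ℂ} (h : q ∉ segment ℝ a b) :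
    (b - q) / (a - q) ∈ slitPlane ∧ a - q ≠ 0 ∧ b - q ≠ 0 := by
  have ha : a - q ≠ 0 := fun h0 => h (by rw [← sub_eq_zero.1 h0]; exact left_mem_segment _ _ _)
  have hb : b - q ≠ 0 := fun h0 => h (by rw [← sub_eq_zero.1 h0]; exact right_mem_segment _ _ _)
  refine ⟨?_, ha, hb⟩
  by_contra hs
  rw [Complex.mem_slitPlane_iff_not_le_zero, not_not, Complex.le_def] at hs
  set r := (b - q) / (a - q) with hr
  simp at hs
  have e : b - q = (r.re : ℂ) * (a - q) := by
    have : r = (r.re : ℂ) := by apply Complex.ext <;> simp [hs.2]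
    rw [← this, hr]; field_simp
  apply h
  have hpos : 0 < 1 - r.re := by linarith [hs.1]
  refine ⟨-r.re / (1 - r.re), 1 / (1 - r.re), div_nonneg (by linarith [hs.1]) hpos.le, by positivity, by field_simp; ring, ?_⟩
  have hne : (1 - (r.re : ℂ)) ≠ 0 := by exact_mod_cast hpos.ne'
  have hbq : b = q + (r.re : ℂ) * (a - q) := by rw [← e]; ring
  rw [hbq]
  simp only [Complex.real_smul]
  push_cast
  field_simp
  ring

lemma continuousOn_wd : ∀ L, ContinuousOn (fun q => wd q L) (trc L)ᶜ
  | [] => by simp [wd]; exact continuousOn_const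
  | [a] => by simp [wd]; exact continuousOn_const
  | a :: b :: t => by
    simp only [wd, trc]
    apply ContinuousOn.add
    · intro q hq
      have hq' : q ∉ segment ℝ a b := fun h => hq (Or.inl h)
      obtain ⟨h1, h2, h3⟩ := ratio_slit hq'
      apply ContinuousAt.continuousWithinAt
      refine ContinuousAt.clog ?_ h1
      exact ContinuousAt.div (by fun_prop) (by fun_prop) h2
    · exact (continuousOn_wd (b :: t)).mono (fun q hq h => hq (Or.inr h))

lemma exp_wd (q : ℂ) : ∀ (L : List ℂ) (a c : ℂ), q ∉ trc (a :: (L ++ [c])) →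
    exp (wd q (a :: (L ++ [c]))) = (c - q) / (a - q)
  | [], a, c => by
    intro h
    simp only [List.nil_append, trc, Set.mem_union, not_or] at h
    obtain ⟨h1, h2, h3⟩ := ratio_slit h.1
    simp only [List.nil_append, wd, add_zero]
    exact exp_log (div_ne_zero h3 h2)
  | b :: t, a, c => by
    intro h
    simp only [List.cons_append, trc, Set.mem_union, not_or] at h
    obtain ⟨h1, h2, h3⟩ := ratio_slit h.1
    simp only [List.cons_append, wd]
    rw [exp_add, exp_log (div_ne_zero h3 h2), exp_wd q t b c h.2]
    field_simp

lemma wd_int {q a : ℂ} {L : List ℂ} (h : q ∉ trc (a :: (L ++ [a]))) :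
    ∃ n : ℤ, wd q (a :: (L ++ [a])) = n * (2 * Real.pi * I) := by
  have := exp_wd q L a a h
  have ha : a - q ≠ 0 := by
    intro h0
    apply h
    rw [← sub_eq_zero.1 h0]
    cases L with
    | nil => simp only [List.nil_append, trc]; exact Or.inl (left_mem_segment _ _ _)
    | cons b t => simp only [List.cons_append, trc]; exact Or.inl (left_mem_segment _ _ _)
  rw [div_self ha, exp_eq_one_iff] at this
  exact this

lemma wd_const {a : ℂ} {L : List ℂ} {S : Set ℂ} (hS : IsPreconnected S)
    (hd : S ⊆ (trc (a :: (L ++ [a])))ᶜ) {x y : ℂ} (hx : x ∈ S) (hy : y ∈ S) :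
    wd x (a :: (L ++ [a])) = wd y (a :: (L ++ [a])) := by
  have hpi : (2 * Real.pi * I : ℂ) ≠ 0 := by simp [Real.pi_ne_zero]
  have hT : DiscreteTopology (Set.range (Int.cast : ℤ → ℝ)) := by
    have := Int.isClosedEmbedding_coe_real.isEmbedding.toHomeomorph
    exact this.symm.isEmbedding.discreteTopology
  have h := hS.constant_of_mapsTo (T := Set.range (Int.cast : ℤ → ℝ))
    (f := fun q => (wd q (a :: (L ++ [a])) / (2 * Real.pi * I)).re)
    ⟨hT⟩ (by
      apply Complex.continuous_re.comp_continuousOn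
      exact ((continuousOn_wd _).mono hd).div_const _)
    (by
      intro q hq
      obtain ⟨n, hn⟩ := wd_int (hd hq)
      refine ⟨n, ?_⟩
      simp only [hn]
      rw [mul_div_assoc, div_self hpi]; simp) hx hy
  obtain ⟨n, hn⟩ := wd_int (hd hx)
  obtain ⟨m, hm⟩ := wd_int (hd hy)
  simp only [hn, hm] at h ⊢
  rw [mul_div_cancel_right₀ _ hpi, mul_div_cancel_right₀ _ hpi] at h
  simp at h
  rw [h]

lemma tendsto_wd : ∀ L, Filter.Tendsto (fun q => wd q L) (Bornology.cobounded ℂ) (nhds 0)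
  | [] => by simp [wd]
  | [a] => by simp [wd]
  | a :: b :: t => by
    simp only [wd]
    rw [← add_zero (0:ℂ)]
    refine Filter.Tendsto.add ?_ (tendsto_wd (b :: t))
    have h1 : Filter.Tendsto (fun q : ℂ => (b - q) / (a - q)) (Bornology.cobounded ℂ) (nhds 1) := by
      have h2 : Filter.Tendsto (fun q : ℂ => 1 + (b - a) * (a - q)⁻¹) (Bornology.cobounded ℂ) (nhds (1 + (b - a) * 0)) := by
        refine Filter.Tendsto.const_add _ (Filter.Tendsto.const_mul _ ?_)
        refine Filter.tendsto_inv₀_cobounded.comp ?_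
        rw [← tendsto_norm_atTop_iff_cobounded]
        refine Filter.tendsto_atTop_mono (fun q => (by
          show ‖q‖ - ‖a‖ ≤ ‖a - q‖
          rw [norm_sub_rev]; exact norm_sub_norm_le _ _)) ?_
        exact Filter.tendsto_atTop_add_const_right _ _ tendsto_norm_cobounded_atTop
      rw [mul_zero, add_zero] at h2
      refine h2.congr' ?_
      have : ∀ᶠ q in Bornology.cobounded ℂ, q ≠ a := by
        have := tendsto_norm_cobounded_atTop (E := ℂ) |>.eventually (Filter.eventually_gt_atTop ‖a‖)
        filter_upwards [this] with q hq h; rw [h] at hq; exact lt_irrefl _ hq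
      filter_upwards [this] with q hq
      have : a - q ≠ 0 := sub_ne_zero.2 hq.symm
      field_simp; ring
    have := h1.clog (by simp)
    simpa using this

lemma wd_eq_zero_of_unbounded {a : ℂ} {L : List ℂ} {S : Set ℂ} (hS : IsPreconnected S)
    (hd : S ⊆ (trc (a :: (L ++ [a])))ᶜ) (hub : ¬ Bornology.IsBounded S) {x : ℂ} (hx : x ∈ S) :
    wd x (a :: (L ++ [a])) = 0 := by
  have h1 : ∀ᶠ q in Bornology.cobounded ℂ, ‖wd q (a :: (L ++ [a]))‖ < 2 * Real.pi := by
    have := (tendsto_wd (a :: (L ++ [a]))).norm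
    rw [norm_zero] at this
    exact this.eventually (gt_mem_nhds (by positivity))
  obtain ⟨y, hy, hyS⟩ : ∃ y, ‖wd y (a :: (L ++ [a]))‖ < 2 * Real.pi ∧ y ∈ S := by
    by_contra hcon
    push Not at hcon
    apply hub
    rw [Bornology.isBounded_def]
    filter_upwards [h1] with y hy
    exact fun h => (hcon y hy h)
  rw [wd_const hS hd hx hyS]
  obtain ⟨n, hn⟩ := wd_int (hd hyS)
  rw [hn] at hy ⊢
  have : n = 0 := by
    by_contra h0
    have h2 : (1:ℝ) ≤ |(n:ℝ)| := by exact_mod_cast Int.one_le_abs h0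
    simp [abs_of_pos Real.pi_pos] at hy
    nlinarith [Real.pi_pos]
  simp [this]

/-- `V` has no bounded complementary pieces. -/
def Full (V : Set ℂ) : Prop :=
  ∀ W : Set ℂ, IsOpen W → IsPreconnected W → Bornology.IsBounded W → frontier W ⊆ V → W ⊆ V

lemma Full.mem_of_wd_ne {V : Set ℂ} (hV : Full V) {a : ℂ} {L : List ℂ}
    (hL : trc (a :: (L ++ [a])) ⊆ V) {q : ℂ} (hq : q ∉ trc (a :: (L ++ [a])))
    (h : wd q (a :: (L ++ [a])) ≠ 0) : q ∈ V := by
  set T := trc (a :: (L ++ [a])) with hT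
  have hop : IsOpen Tᶜ := (isCompact_trc _).isClosed.isOpen_compl
  have hmem : q ∈ connectedComponentIn Tᶜ q := mem_connectedComponentIn hq
  refine hV (connectedComponentIn Tᶜ q) hop.connectedComponentIn isPreconnected_connectedComponentIn
    ?_ ?_ hmem
  · by_contra hub
    exact h (wd_eq_zero_of_unbounded isPreconnected_connectedComponentIn
      (connectedComponentIn_subset _ _) hub hmem)
  · intro x hx
    by_contra hxV
    have hxT : x ∈ Tᶜ := fun hh => hxV (hL hh)
    have h1 : connectedComponentIn Tᶜ x ∈ nhds x :=
      hop.connectedComponentIn.mem_nhds (mem_connectedComponentIn hxT)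
    obtain ⟨y, hy1, hy2⟩ := mem_closure_iff_nhds.1 (frontier_subset_closure hx) _ h1
    have e1 := connectedComponentIn_eq hy1
    have e2 := connectedComponentIn_eq hy2
    rw [hop.connectedComponentIn.frontier_eq] at hx
    apply hx.2
    rw [e2, ← e1]
    exact mem_connectedComponentIn hxT
end NWD

namespace NWD
open Complex

/-- grid embedding -/
noncomputable def eg (δ : ℝ) (u : ℤ × ℤ) : ℂ := ⟨δ * u.1, δ * u.2⟩

/-- grid neighbours -/
def Nb (u v : ℤ × ℤ) : Prop :=
  u = (v.1 - 1, v.2) ∨ u = (v.1, v.2 - 1) ∨ u = (v.1 + 1, v.2) ∨ u = (v.1, v.2 + 1)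

/-- grid neighbours connected in `V` -/
def Adj (δ : ℝ) (V : Set ℂ) (u v : ℤ × ℤ) : Prop :=
  Nb u v ∧ segment ℝ (eg δ u) (eg δ v) ⊆ V

lemma Nb.symm {u v : ℤ × ℤ} (h : Nb u v) : Nb v u := by
  unfold Nb at *
  simp only [Prod.ext_iff] at *
  omega

lemma Adj.symm {δ V} {u v : ℤ × ℤ} (h : Adj δ V u v) : Adj δ V v u :=
  ⟨h.1.symm, by rw [segment_symm]; exact h.2⟩

lemma seg_param {δ : ℝ} {a b : ℤ × ℤ} {q : ℂ} (h : q ∈ segment ℝ (eg δ a) (eg δ b)) :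
    ∃ s : ℝ, 0 ≤ s ∧ s ≤ 1 ∧ q.re = δ * (a.1 + s * (b.1 - a.1)) ∧
      q.im = δ * (a.2 + s * (b.2 - a.2)) := by
  rw [segment_eq_image_lineMap] at h
  obtain ⟨s, ⟨h0, h1⟩, rfl⟩ := h
  refine ⟨s, h0, h1, ?_, ?_⟩
  · simp [AffineMap.lineMap_apply, eg]; ring
  · simp [AffineMap.lineMap_apply, eg]; ring

lemma mem_trc_map {δ : ℝ} {R : ℤ × ℤ → ℤ × ℤ → Prop} {q : ℂ} : ∀ (L : List (ℤ × ℤ)) (a b : ℤ × ℤ),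
    List.IsChain R (a :: b :: L) → q ∈ trc ((a :: b :: L).map (eg δ)) →
    ∃ u ∈ a :: b :: L, ∃ v ∈ a :: b :: L, R u v ∧ q ∈ segment ℝ (eg δ u) (eg δ v)
  | [], a, b => by
    intro h hq
    simp only [List.map_cons, List.map_nil, trc] at hq
    refine ⟨a, by simp, b, by simp, by simpa using h, ?_⟩
    rcases hq with hq | hq
    · exact hq
    · rw [hq]; exact right_mem_segment _ _ _
  | c :: t, a, b => by
    intro h hq
    rw [List.isChain_cons_cons] at h
    simp only [List.map_cons, trc] at hq
    rcases hq with hq | hq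
    · exact ⟨a, by simp, b, by simp, h.1, hq⟩
    · obtain ⟨u, hu, v, hv, h1, h2⟩ := mem_trc_map t b c h.2 (by simpa [trc] using hq)
      exact ⟨u, List.mem_cons_of_mem _ hu, v, List.mem_cons_of_mem _ hv, h1, h2⟩

lemma level_le {δ : ℝ} (hδ : 0 < δ) {a b : ℤ × ℤ} {m : ℤ} {q : ℂ}
    (h : q ∈ segment ℝ (eg δ a) (eg δ b)) (ha : a.1 + a.2 ≤ m) (hb : b.1 + b.2 ≤ m) :
    q.re + q.im ≤ δ * m := by
  obtain ⟨s, h0, h1, h2, h3⟩ := seg_param h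
  rw [h2, h3, ← mul_add]
  apply mul_le_mul_of_nonneg_left _ hδ.le
  have ha' : (a.1 : ℝ) + a.2 ≤ m := by exact_mod_cast ha
  have hb' : (b.1 : ℝ) + b.2 ≤ m := by exact_mod_cast hb
  nlinarith [mul_le_mul_of_nonneg_left hb' h0, mul_le_mul_of_nonneg_left ha' (sub_nonneg.2 h1)]

lemma vertex_not_mem {δ : ℝ} (hδ : 0 < δ) {a b v : ℤ × ℤ} (hab : Nb a b)
    (ha : a.1 + a.2 ≤ v.1 + v.2) (hb : b.1 + b.2 ≤ v.1 + v.2) (hav : a ≠ v) (hbv : b ≠ v) :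
    eg δ v ∉ segment ℝ (eg δ a) (eg δ b) := by
  intro h
  obtain ⟨s, h0, h1, h2, h3⟩ := seg_param h
  simp only [eg] at h2 h3
  have h2 := mul_left_cancel₀ hδ.ne' h2
  have h3 := mul_left_cancel₀ hδ.ne' h3
  rw [Ne, Prod.ext_iff] at hav hbv
  rcases hab with e | e | e | e <;> rw [e] at ha hav h2 h3 <;> push_cast at * <;> simp at ha hav h2 h3
  · have : v.2 = b.2 := by exact_mod_cast h3
    have h4 : (v.1:ℝ) ≤ b.1 := by linarith
    have h4 : v.1 ≤ b.1 := by exact_mod_cast h4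
    exact hbv ⟨by omega, by omega⟩
  · have : v.1 = b.1 := by exact_mod_cast h2
    have h4 : (v.2:ℝ) ≤ b.2 := by linarith
    have h4 : v.2 ≤ b.2 := by exact_mod_cast h4
    exact hbv ⟨by omega, by omega⟩
  · have : v.2 = b.2 := by exact_mod_cast h3
    have h4 : (v.1:ℝ) ≤ b.1 + 1 := by linarith
    have h4 : v.1 ≤ b.1 + 1 := by exact_mod_cast h4
    exact hav (by omega) (by omega)
  · have : v.1 = b.1 := by exact_mod_cast h2
    have h4 : (v.2:ℝ) ≤ b.2 + 1 := by linarith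
    have h4 : v.2 ≤ b.2 + 1 := by exact_mod_cast h4
    exact hav (by omega) (by omega)

/-- open grid square with upper right corner `v` -/
def osq (δ : ℝ) (v : ℤ × ℤ) : Set ℂ :=
  {z | δ * (v.1 - 1) < z.re ∧ z.re < δ * v.1 ∧ δ * (v.2 - 1) < z.im ∧ z.im < δ * v.2}

/-- closed grid square with upper right corner `v` -/
def csq (δ : ℝ) (v : ℤ × ℤ) : Set ℂ :=
  {z | δ * (v.1 - 1) ≤ z.re ∧ z.re ≤ δ * v.1 ∧ δ * (v.2 - 1) ≤ z.im ∧ z.im ≤ δ * v.2}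

lemma convex_osq (δ v) : Convex ℝ (osq δ v) := by
  have h1 : osq δ v = {z : ℂ | δ * (v.1 - 1) < z.re} ∩ ({z | z.re < δ * v.1} ∩
    ({z | δ * (v.2 - 1) < z.im} ∩ {z | z.im < δ * v.2})) := by
    ext z; simp [osq]
  rw [h1]
  exact (convex_halfSpace_re_gt _).inter ((convex_halfSpace_re_lt _).inter
    ((convex_halfSpace_im_gt _).inter (convex_halfSpace_im_lt _)))

lemma convex_csq (δ v) : Convex ℝ (csq δ v) := by
  have h1 : csq δ v = {z : ℂ | δ * (v.1 - 1) ≤ z.re} ∩ ({z | z.re ≤ δ * v.1} ∩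
    ({z | δ * (v.2 - 1) ≤ z.im} ∩ {z | z.im ≤ δ * v.2})) := by
    ext z; simp [csq]
  rw [h1]
  exact (convex_halfSpace_re_ge _).inter ((convex_halfSpace_re_le _).inter
    ((convex_halfSpace_im_ge _).inter (convex_halfSpace_im_le _)))

lemma osq_disj {δ : ℝ} (hδ : 0 < δ) {a b v : ℤ × ℤ} (hab : Nb a b) {q : ℂ} (hq : q ∈ osq δ v) :
    q ∉ segment ℝ (eg δ a) (eg δ b) := by
  intro h
  obtain ⟨s, h0, h1, h2, h3⟩ := seg_param h
  obtain ⟨q1, q2, q3, q4⟩ := hq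
  rw [h2] at q1 q2
  rw [h3] at q3 q4
  have q1 := lt_of_mul_lt_mul_left q1 hδ.le
  have q2 := lt_of_mul_lt_mul_left q2 hδ.le
  have q3 := lt_of_mul_lt_mul_left q3 hδ.le
  have q4 := lt_of_mul_lt_mul_left q4 hδ.le
  rcases hab with e | e | e | e <;> rw [e] at q1 q2 q3 q4 <;> simp at q1 q2 q3 q4
  · have a1 : v.2 - 1 < b.2 := by exact_mod_cast q3
    have a2 : b.2 < v.2 := by exact_mod_cast q4
    omega
  · have a1 : v.1 - 1 < b.1 := by exact_mod_cast q1
    have a2 : b.1 < v.1 := by exact_mod_cast q2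
    omega
  · have a1 : v.2 - 1 < b.2 := by exact_mod_cast q3
    have a2 : b.2 < v.2 := by exact_mod_cast q4
    omega
  · have a1 : v.1 - 1 < b.1 := by exact_mod_cast q1
    have a2 : b.1 < v.1 := by exact_mod_cast q2
    omega

lemma csq_subset_closure {δ : ℝ} (hδ : 0 < δ) (v) : csq δ v ⊆ closure (osq δ v) := by
  intro z hz
  set c : ℂ := ⟨δ * (v.1 - 1/2), δ * (v.2 - 1/2)⟩ with hc
  have : Filter.Tendsto (fun t : ℝ => z + (t:ℂ) * (c - z)) (nhdsWithin 0 (Set.Ioi 0)) (nhds z) := by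
    apply tendsto_nhdsWithin_of_tendsto_nhds
    have : Continuous (fun t : ℝ => z + (t:ℂ) * (c - z)) := by fun_prop
    simpa using this.tendsto 0
  refine mem_closure_of_tendsto this ?_
  have hI : Set.Ioo (0:ℝ) 1 ∈ nhdsWithin (0:ℝ) (Set.Ioi 0) := Ioo_mem_nhdsGT one_pos
  filter_upwards [hI] with t ht
  obtain ⟨z1, z2, z3, z4⟩ := hz
  obtain ⟨t0, t1⟩ := ht
  simp only [osq, Set.mem_setOf_eq, add_re, mul_re, ofReal_re, ofReal_im, sub_re, zero_mul, sub_zero,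
    add_im, mul_im, sub_im, add_zero, hc]
  refine ⟨?_, ?_, ?_, ?_⟩ <;> nlinarith [mul_pos t0 hδ, mul_nonneg (sub_nonneg.2 t1.le) (sub_nonneg.2 z1), mul_nonneg (sub_nonneg.2 t1.le) (sub_nonneg.2 z2), mul_nonneg (sub_nonneg.2 t1.le) (sub_nonneg.2 z3), mul_nonneg (sub_nonneg.2 t1.le) (sub_nonneg.2 z4)]
end NWD

namespace NWD
open Complex

lemma log_flip {q a b : ℂ} (h : q ∉ segment ℝ a b) :
    log ((a - q) / (b - q)) = - log ((b - q) / (a - q)) := by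
  obtain ⟨h1, _, _⟩ := ratio_slit h
  rw [← inv_div, Complex.log_inv _ (Complex.mem_slitPlane_iff_arg.1 h1).1]

lemma wd_square_ne {δ : ℝ} (hδ : 0 < δ) (v x y : ℤ × ℤ)
    (hcase : ((x = (v.1 - 1, v.2) ∧ y = (v.1, v.2 - 1)) ∨
      (y = (v.1 - 1, v.2) ∧ x = (v.1, v.2 - 1)))) {q : ℂ} (hq : q ∈ osq δ v) :
    wd q (eg δ y :: ([eg δ v, eg δ x, eg δ (v.1 - 1, v.2 - 1)] ++ [eg δ y])) ≠ 0 := by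
  set c : ℂ := ⟨δ * (v.1 - 1/2), δ * (v.2 - 1/2)⟩ with hc
  have hcm : c ∈ osq δ v := by
    simp only [osq, Set.mem_ofPred_eq, hc]
    refine ⟨?_, ?_, ?_, ?_⟩ <;> nlinarith
  have hd : osq δ v ⊆ (trc (eg δ y :: ([eg δ v, eg δ x, eg δ (v.1 - 1, v.2 - 1)] ++ [eg δ y])))ᶜ := by
    intro q hq hm
    have hch : List.IsChain Nb [y, v, x, (v.1 - 1, v.2 - 1), y] := by
      simp only [List.isChain_cons_cons, List.isChain_singleton, Nb]
      rcases hcase with ⟨rfl, rfl⟩ | ⟨rfl, rfl⟩ <;> simp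
    obtain ⟨a, _, b, _, h1, h2⟩ := mem_trc_map (δ := δ) _ _ _ hch (by simpa using hm)
    exact osq_disj hδ h1 hq h2
  rw [wd_const (convex_osq δ v).isPreconnected hd hq hcm]
  have hδ' : (δ : ℂ) ≠ 0 := by exact_mod_cast hδ.ne'
  have hδ2 : (δ / 2 : ℂ) ≠ 0 := by simpa using hδ.ne'
  have ev : eg δ v - c = (δ / 2 : ℂ) * (1 + I) := by
    apply Complex.ext <;> simp [eg, hc] <;> ring
  have ed : eg δ (v.1 - 1, v.2 - 1) - c = (δ / 2 : ℂ) * (-1 - I) := by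
    apply Complex.ext <;> simp [eg, hc] <;> ring
  have el : eg δ (v.1 - 1, v.2) - c = (δ / 2 : ℂ) * (-1 + I) := by
    apply Complex.ext <;> simp [eg, hc] <;> ring
  have eb : eg δ (v.1, v.2 - 1) - c = (δ / 2 : ℂ) * (1 - I) := by
    apply Complex.ext <;> simp [eg, hc] <;> ring
  have n1 : (1 + I : ℂ) ≠ 0 := by intro h; simpa using congrArg re h
  have n2 : (1 - I : ℂ) ≠ 0 := by intro h; simpa using congrArg re h
  have n3 : (-1 - I : ℂ) ≠ 0 := by intro h; simpa using congrArg re h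
  have n4 : (-1 + I : ℂ) ≠ 0 := by intro h; simpa using congrArg re h
  have hI := I_mul_I
  rcases hcase with ⟨rfl, rfl⟩ | ⟨rfl, rfl⟩
  · simp only [wd, List.cons_append, List.nil_append, ev, ed, el, eb, add_zero]
    simp only [mul_div_mul_left _ _ hδ2]
    have r1 : (1 + I) / (1 - I) = I := by rw [div_eq_iff n2]; linear_combination hI
    have r2 : (-1 + I) / (1 + I) = I := by rw [div_eq_iff n1]; linear_combination -hI
    have r3 : (-1 - I) / (-1 + I) = I := by rw [div_eq_iff n4]; linear_combination -hI
    have r4 : (1 - I) / (-1 - I) = I := by rw [div_eq_iff n3]; linear_combination hI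
    rw [r1, r2, r3, r4, log_I]
    intro h
    have := congrArg im h
    simp at this
    linarith [Real.pi_pos]
  · simp only [wd, List.cons_append, List.nil_append, ev, ed, el, eb, add_zero]
    simp only [mul_div_mul_left _ _ hδ2]
    have r1 : (1 + I) / (-1 + I) = -I := by rw [div_eq_iff n4]; linear_combination hI
    have r2 : (1 - I) / (1 + I) = -I := by rw [div_eq_iff n1]; linear_combination hI
    have r3 : (-1 - I) / (1 - I) = -I := by rw [div_eq_iff n2]; linear_combination -hI
    have r4 : (-1 + I) / (-1 - I) = -I := by rw [div_eq_iff n3]; linear_combination -hI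
    rw [r1, r2, r3, r4, log_neg_I]
    intro h
    have := congrArg im h
    simp at this
    linarith [Real.pi_pos]

theorem square_sub {V : Set ℂ} (hV : Full V) {δ : ℝ} (hδ : 0 < δ) (v x y : ℤ × ℤ)
    (l : List (ℤ × ℤ))
    (hch : List.IsChain (Adj δ V) (v :: x :: (l ++ [y, v]))) (hnot : v ∉ x :: (l ++ [y]))
    (hmax : ∀ w ∈ x :: (l ++ [y]), w.1 + w.2 ≤ v.1 + v.2)
    (hcase : ((x = (v.1 - 1, v.2) ∧ y = (v.1, v.2 - 1)) ∨
      (y = (v.1 - 1, v.2) ∧ x = (v.1, v.2 - 1)))) : csq δ v ⊆ V := by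
  set d : ℤ × ℤ := (v.1 - 1, v.2 - 1) with hd
  have hchN : List.IsChain Nb (v :: x :: (l ++ [y, v])) := hch.imp (fun _ _ h => h.1)
  have hchN' : List.IsChain Nb (d :: x :: (l ++ [y, d])) := by
    have e : ∀ a, a :: x :: (l ++ [y, a]) = (a :: x :: l) ++ y :: [a] := by simp
    rw [e, List.isChain_split] at hchN ⊢
    simp only [List.cons_append, List.isChain_cons_cons] at hchN ⊢
    refine ⟨⟨?_, hchN.1.2⟩, ?_, by simp⟩
    · simp only [Nb, hd]; rcases hcase with ⟨rfl, rfl⟩ | ⟨rfl, rfl⟩ <;> simp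
    · simp only [Nb, hd]; rcases hcase with ⟨rfl, rfl⟩ | ⟨rfl, rfl⟩ <;> simp
  set L := eg δ v :: ((eg δ x :: (l ++ [y]).map (eg δ)) ++ [eg δ v]) with hL
  set L' := eg δ d :: ((eg δ x :: (l ++ [y]).map (eg δ)) ++ [eg δ d]) with hL'
  have eL : L = (v :: x :: (l ++ [y, v])).map (eg δ) := by simp [hL]
  have eL' : L' = (d :: x :: (l ++ [y, d])).map (eg δ) := by simp [hL']
  have hLV : trc L ⊆ V := by
    intro q hq
    rw [eL] at hq
    obtain ⟨a, _, b, _, h1, h2⟩ := mem_trc_map _ _ _ hch hq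
    exact h1.2 h2
  have hmem' : ∀ w ∈ d :: x :: (l ++ [y, d]), w.1 + w.2 ≤ v.1 + v.2 ∧ w ≠ v := by
    intro w hw
    have : w = d ∨ w ∈ x :: (l ++ [y]) := by simp at hw ⊢; tauto
    rcases this with rfl | h
    · simp [hd, Prod.ext_iff]; omega
    · exact ⟨hmax w h, fun e => hnot (e ▸ h)⟩
  have hhalf : Convex ℝ {z : ℂ | δ * ((v.1 + v.2 : ℤ) : ℝ) < z.re + z.im} := by
    have : {z : ℂ | δ * ((v.1 + v.2 : ℤ) : ℝ) < z.re + z.im} = {z | δ * ((v.1 + v.2 : ℤ) : ℝ) < (Complex.reLm + Complex.imLm) z} := rfl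
    rw [this]
    exact convex_halfSpace_gt (LinearMap.isLinear _) _
  set H := {z : ℂ | δ * ((v.1 + v.2 : ℤ) : ℝ) < z.re + z.im} with hH
  have hHd : H ⊆ (trc L')ᶜ := by
    intro z hz hm
    rw [eL'] at hm
    obtain ⟨a, ha, b, hb, h1, h2⟩ := mem_trc_map _ _ _ hchN' hm
    have := level_le hδ h2 (hmem' a ha).1 (hmem' b hb).1
    simp only [hH, Set.mem_ofPred_eq] at hz
    linarith
  have hHu : ¬ Bornology.IsBounded H := by
    intro hb
    obtain ⟨C, hC⟩ := hb.exists_norm_le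
    set t : ℝ := |δ * ((v.1 + v.2 : ℤ) : ℝ)| + |C| + 1
    have ht : (t : ℂ) ∈ H := by
      simp only [hH, Set.mem_ofPred_eq, ofReal_re, ofReal_im, t]
      linarith [le_abs_self (δ * ((v.1 + v.2 : ℤ) : ℝ)), abs_nonneg C]
    have := hC _ ht
    rw [norm_real, Real.norm_eq_abs] at this
    have h2 := le_abs_self t
    have h3 : t = |δ * ((v.1 + v.2 : ℤ) : ℝ)| + |C| + 1 := rfl
    linarith [le_abs_self C, abs_nonneg (δ * ((v.1 + v.2 : ℤ) : ℝ))]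
  have hvn : eg δ v ∈ (trc L')ᶜ := by
    intro hm
    rw [eL'] at hm
    obtain ⟨a, ha, b, hb, h1, h2⟩ := mem_trc_map _ _ _ hchN' hm
    exact vertex_not_mem hδ h1 (hmem' a ha).1 (hmem' b hb).1 (hmem' a ha).2 (hmem' b hb).2 h2
  obtain ⟨ρ, hρ, hball⟩ := Metric.isOpen_iff.1 (isCompact_trc L').isClosed.isOpen_compl _ hvn
  set ε : ℝ := min (ρ / 4) (δ / 2) with hε
  have hε0 : 0 < ε := by positivity
  have hε1 : ε ≤ ρ / 4 := min_le_left _ _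
  have hε2 : ε ≤ δ / 2 := min_le_right _ _
  have hnI : ‖(ε : ℂ) * (1 + I)‖ < ρ := by
    rw [norm_mul, norm_real, Real.norm_eq_abs, abs_of_pos hε0]
    have : ‖(1 + I : ℂ)‖ ≤ 2 := (norm_add_le _ _).trans (by simp; norm_num)
    nlinarith
  set q0 := eg δ v + (ε : ℂ) * (1 + I) with hq0
  set q1 := eg δ v - (ε : ℂ) * (1 + I) with hq1
  have b0 : q0 ∈ Metric.ball (eg δ v) ρ := by simp [hq0, dist_eq_norm] at hnI ⊢; exact hnI
  have b1 : q1 ∈ Metric.ball (eg δ v) ρ := by simp [hq1, dist_eq_norm] at hnI ⊢; exact hnI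
  have z1 : wd q1 L' = 0 := by
    rw [wd_const (convex_ball _ _).isPreconnected hball b1 b0]
    refine wd_eq_zero_of_unbounded hhalf.isPreconnected hHd hHu ?_
    simp only [hH, Set.mem_ofPred_eq, hq0, eg]
    simp
    linarith
  have hq1o : q1 ∈ osq δ v := by
    simp only [osq, Set.mem_ofPred_eq, hq1, eg]
    simp
    refine ⟨?_, ?_, ?_, ?_⟩ <;> nlinarith
  have hod : osq δ v ⊆ (trc L)ᶜ := by
    intro z hz hm
    rw [eL] at hm
    obtain ⟨a, ha, b, hb, h1, h2⟩ := mem_trc_map _ _ _ hchN hm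
    exact osq_disj hδ h1 hz h2
  have z2 : wd q1 L ≠ 0 := by
    have hsq := wd_square_ne hδ v x y hcase hq1o
    have e1 : ∀ a : ℂ, wd q1 (a :: ((eg δ x :: (l ++ [y]).map (eg δ)) ++ [a])) =
        log ((eg δ x - q1) / (a - q1)) + wd q1 (eg δ x :: (l.map (eg δ) ++ [eg δ y])) +
          log ((a - q1) / (eg δ y - q1)) := by
      intro a
      have : a :: ((eg δ x :: (l ++ [y]).map (eg δ)) ++ [a]) =
        (a :: eg δ x :: l.map (eg δ)) ++ eg δ y :: [a] := by simp
      rw [this, wd_split]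
      simp [wd]
    have hn1 : Nb x d := by simp only [Nb, hd]; rcases hcase with ⟨rfl, rfl⟩ | ⟨rfl, rfl⟩ <;> simp
    have hn2 : Nb d y := by simp only [Nb, hd]; rcases hcase with ⟨rfl, rfl⟩ | ⟨rfl, rfl⟩ <;> simp
    rw [hL', e1] at z1
    rw [hL, e1]
    simp only [wd, List.cons_append, List.nil_append, add_zero] at hsq
    rw [log_flip (osq_disj hδ hn1 hq1o), log_flip (osq_disj hδ hn2 hq1o)] at z1
    intro h0
    apply hsq
    linear_combination h0 - z1
  intro p hp
  by_cases hpL : p ∈ trc L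
  · exact hLV hpL
  · have hS : IsPreconnected (csq δ v ∩ (trc L)ᶜ) := by
      refine (convex_osq δ v).isPreconnected.subset_closure ?_
        (Set.inter_subset_left.trans (csq_subset_closure hδ v))
      intro z hz
      exact ⟨⟨hz.1.le, hz.2.1.le, hz.2.2.1.le, hz.2.2.2.le⟩, hod hz⟩
    have hqS : q1 ∈ csq δ v ∩ (trc L)ᶜ :=
      ⟨⟨hq1o.1.le, hq1o.2.1.le, hq1o.2.2.1.le, hq1o.2.2.2.le⟩, hod hq1o⟩
    refine hV.mem_of_wd_ne hLV hpL ?_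
    rw [wd_const hS Set.inter_subset_right ⟨hp, hpL⟩ hqS]
    exact z2
end NWD

namespace NWD
open Complex

section Hom
variable {V : Set ℂ}

lemma conv_hom {C : Set ℂ} (hC : Convex ℝ C) (hCV : C ⊆ V) {x y : V} (p q : Path x y)
    (hp : ∀ t, (p t : ℂ) ∈ C) (hq : ∀ t, (q t : ℂ) ∈ C) :
    Path.Homotopic.Quotient.mk p = Path.Homotopic.Quotient.mk q := by
  rw [Path.Homotopic.Quotient.eq]
  have hm : ∀ s : unitInterval × unitInterval,
      (AffineMap.lineMap (k := ℝ) (p s.2 : ℂ) (q s.2 : ℂ) (s.1 : ℝ)) ∈ C := fun s =>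
    hC.lineMap_mem (hp _) (hq _) s.1.2
  refine ⟨⟨⟨⟨fun s => ⟨_, hCV (hm s)⟩, ?_⟩, ?_, ?_⟩, ?_⟩⟩
  · refine Continuous.subtype_mk ?_ _
    simp only [AffineMap.lineMap_apply]
    simp only [vsub_eq_sub, vadd_eq_add]
    fun_prop
  · intro t; apply Subtype.ext; simp
  · intro t; apply Subtype.ext; simp
  · intro t s hs
    apply Subtype.ext
    rcases hs with rfl | rfl <;> simp

variable [PathConnectedSpace V] (b : V)

/-- chosen path class from the base point -/
noncomputable def cc (x : V) : Path.Homotopic.Quotient b x :=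
  Path.Homotopic.Quotient.mk (PathConnectedSpace.joined b x).somePath

/-- loop class of a path class -/
noncomputable def Ps {x y : V} (q : Path.Homotopic.Quotient x y) : FundamentalGroup V b :=
  (cc b y).trans (q.symm.trans (cc b x).symm)

lemma Ps_trans {x y z : V} (q : Path.Homotopic.Quotient x y) (r : Path.Homotopic.Quotient y z) :
    Ps b (q.trans r) = Ps b q * Ps b r := by
  rw [FundamentalGroup.mul_def]
  unfold Ps
  have : (q.trans r).symm = r.symm.trans q.symm := by
    calc (q.trans r).symm = ((q.trans r).symm.trans (q.trans r)).trans (r.symm.trans q.symm) := by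
          rw [Path.Homotopic.Quotient.trans_assoc, Path.Homotopic.Quotient.trans_assoc,
            ← Path.Homotopic.Quotient.trans_assoc r]
          simp
      _ = _ := by simp
  rw [this]
  show _ = Path.Homotopic.Quotient.trans _ _
  simp only [Path.Homotopic.Quotient.trans_assoc]
  rw [← Path.Homotopic.Quotient.trans_assoc (cc b y).symm]
  simp

lemma Ps_eq_one {x : V} {q : Path.Homotopic.Quotient x x} (h : Ps b q = 1) :
    q = Path.Homotopic.Quotient.refl x := by
  rw [FundamentalGroup.one_def] at h
  unfold Ps at h
  have h2 : q.symm = (cc b x).symm.trans (((cc b x).trans (q.symm.trans (cc b x).symm)).trans (cc b x)) := by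
    simp only [Path.Homotopic.Quotient.trans_assoc]
    rw [← Path.Homotopic.Quotient.trans_assoc (cc b x).symm]
    simp
  rw [h] at h2
  simp at h2
  calc q = q.trans (Path.Homotopic.Quotient.refl x) := by simp
    _ = q.trans q.symm := by rw [h2]
    _ = _ := by simp

/-- a path along a segment -/
noncomputable def segPath {x y : ℂ} (h : segment ℝ x y ⊆ V) :
    Path (⟨x, h (left_mem_segment _ _ _)⟩ : V) ⟨y, h (right_mem_segment _ _ _)⟩ where
  toFun t := ⟨AffineMap.lineMap (k := ℝ) x y (t : ℝ), h (by
    rw [segment_eq_image_lineMap]; exact ⟨t, t.2, rfl⟩)⟩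
  continuous_toFun := by
    refine Continuous.subtype_mk ?_ _
    simp only [AffineMap.lineMap_apply]
    simp only [vsub_eq_sub, vadd_eq_add]
    fun_prop
  source' := by simp
  target' := by simp

lemma segPath_mem {x y : ℂ} (h : segment ℝ x y ⊆ V) (t) : (segPath h t : ℂ) ∈ segment ℝ x y := by
  rw [segment_eq_image_lineMap]; exact ⟨t, t.2, rfl⟩

open Classical in
/-- holonomy of a segment -/
noncomputable def gs (x y : ℂ) : FundamentalGroup V b :=
  if h : segment ℝ x y ⊆ V then Ps b (Path.Homotopic.Quotient.mk (segPath h)) else 1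

lemma gs_mul {C : Set ℂ} (hC : Convex ℝ C) (hCV : C ⊆ V) {x y z : ℂ} (hx : x ∈ C) (hy : y ∈ C)
    (hz : z ∈ C) : gs b x y * gs b y z = gs b x z := by
  have h1 : segment ℝ x y ⊆ V := (hC.segment_subset hx hy).trans hCV
  have h2 : segment ℝ y z ⊆ V := (hC.segment_subset hy hz).trans hCV
  have h3 : segment ℝ x z ⊆ V := (hC.segment_subset hx hz).trans hCV
  rw [gs, gs, gs, dif_pos h1, dif_pos h2, dif_pos h3, ← Ps_trans, ← Path.Homotopic.Quotient.mk_trans]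
  congr 1
  refine conv_hom hC hCV _ _ ?_ (fun t => hC.segment_subset hx hz (segPath_mem h3 t))
  intro t
  have : ((segPath h1).trans (segPath h2)) t ∈ Set.range ((segPath h1).trans (segPath h2)) := ⟨t, rfl⟩
  rw [Path.trans_range] at this
  rcases this with ⟨s, hs⟩ | ⟨s, hs⟩
  · rw [← hs]; exact hC.segment_subset hx hy (segPath_mem h1 s)
  · rw [← hs]; exact hC.segment_subset hy hz (segPath_mem h2 s)

lemma Ps_eq_gs {C : Set ℂ} (hC : Convex ℝ C) (hCV : C ⊆ V) {x y : V} (p : Path x y)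
    (hp : ∀ t, (p t : ℂ) ∈ C) : Ps b (Path.Homotopic.Quotient.mk p) = gs b (x : ℂ) (y : ℂ) := by
  have hx : (x : ℂ) ∈ C := by simpa using hp 0
  have hy : (y : ℂ) ∈ C := by simpa using hp 1
  have h1 : segment ℝ (x : ℂ) y ⊆ V := (hC.segment_subset hx hy).trans hCV
  rw [gs, dif_pos h1]
  congr 1
  exact conv_hom hC hCV _ _ hp (fun t => hC.segment_subset hx hy (segPath_mem h1 t))

lemma gs_self {x : ℂ} (hx : x ∈ V) : gs b x x = 1 := by
  have := gs_mul b (C := {x}) (convex_singleton x) (by simpa using hx) rfl rfl rfl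
  exact mul_eq_left.1 this

end Hom

/-- connectivity of grid points with recorded holonomy -/
inductive Conn {G : Type*} [Group G] (g : ℤ × ℤ → ℤ × ℤ → G) (A : ℤ × ℤ → ℤ × ℤ → Prop)
    (u : ℤ × ℤ) : ℤ × ℤ → G → Prop
  | refl : Conn g A u u 1
  | step {v w : ℤ × ℤ} {x : G} : Conn g A u v x → A v w → Conn g A u w (x * g v w)

lemma Conn.trans {G : Type*} [Group G] {g : ℤ × ℤ → ℤ × ℤ → G} {A : ℤ × ℤ → ℤ × ℤ → Prop}
    {u v w : ℤ × ℤ} {x y : G} (h : Conn g A u v x) (h' : Conn g A v w y) : Conn g A u w (x * y) := by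
  induction h' with
  | refl => simpa using h
  | step h1 h2 ih => rw [← mul_assoc]; exact ih.step h2

lemma Conn.exists_list {G : Type*} [Group G] {g : ℤ × ℤ → ℤ × ℤ → G} {A : ℤ × ℤ → ℤ × ℤ → Prop}
    {u w : ℤ × ℤ} {x : G} (h : Conn g A u w x) : (u = w ∧ x = 1) ∨
      ∃ l : List (ℤ × ℤ), List.IsChain A (u :: (l ++ [w])) ∧ hol g (u :: (l ++ [w])) = x := by
  induction h with
  | refl => simp
  | @step v w x h1 h2 ih =>
    right
    rcases ih with ⟨rfl, rfl⟩ | ⟨l, hl, rfl⟩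
    · exact ⟨[], by simpa using h2, by simp [hol]⟩
    · refine ⟨l ++ [v], ?_, ?_⟩
      · have : u :: ((l ++ [v]) ++ [w]) = (u :: l) ++ v :: [w] := by simp
        rw [this, List.isChain_split]
        exact ⟨by simpa using hl, by simpa using h2⟩
      · have : u :: ((l ++ [v]) ++ [w]) = (u :: l) ++ v :: [w] := by simp
        rw [this, hol_split]
        simp [hol]

section Main
variable {V : Set ℂ} [PathConnectedSpace V] (b : V)

lemma conn_line {C : Set ℂ} (hC : Convex ℝ C) (hCV : C ⊆ V) {δ : ℝ} {u : ℤ × ℤ} (hu : eg δ u ∈ C)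
    (s : ℤ × ℤ) (hs : s = (1, 0) ∨ s = (-1, 0) ∨ s = (0, 1) ∨ s = (0, -1)) (v : ℤ × ℤ)
    (hv : Conn (fun a c => gs b (eg δ a) (eg δ c)) (Adj δ V) u v (gs b (eg δ u) (eg δ v))) (n : ℕ) :
    (∀ k ≤ n, eg δ (v.1 + k * s.1, v.2 + k * s.2) ∈ C) →
    Conn (fun a c => gs b (eg δ a) (eg δ c)) (Adj δ V) u (v.1 + n * s.1, v.2 + n * s.2)
      (gs b (eg δ u) (eg δ (v.1 + n * s.1, v.2 + n * s.2))) := by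
  induction n with
  | zero => intro _; simpa using hv
  | succ n ih =>
    intro h
    have h1 := ih (fun k hk => h k (by omega))
    have hA : Adj δ V (v.1 + n * s.1, v.2 + n * s.2) (v.1 + (n + 1 : ℕ) * s.1, v.2 + (n + 1 : ℕ) * s.2) := by
      refine ⟨?_, (hC.segment_subset (h n (by omega)) (h (n+1) le_rfl)).trans hCV⟩
      unfold Nb
      simp only [Prod.ext_iff]
      rcases hs with rfl | rfl | rfl | rfl <;> push_cast <;> simp <;> omega
    have h2 := h1.step hA
    rwa [gs_mul b hC hCV hu (h n (by omega)) (h (n+1) le_rfl)] at h2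

/-- open box -/
def box (p : ℂ) (ε : ℝ) : Set ℂ :=
  {z | p.re - ε < z.re ∧ z.re < p.re + ε ∧ p.im - ε < z.im ∧ z.im < p.im + ε}

lemma convex_box (p ε) : Convex ℝ (box p ε) := by
  have h1 : box p ε = {z : ℂ | p.re - ε < z.re} ∩ ({z | z.re < p.re + ε} ∩
    ({z | p.im - ε < z.im} ∩ {z | z.im < p.im + ε})) := by
    ext z; simp [box]
  rw [h1]
  exact (convex_halfSpace_re_gt _).inter ((convex_halfSpace_re_lt _).inter
    ((convex_halfSpace_im_gt _).inter (convex_halfSpace_im_lt _)))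

lemma conn_box {p : ℂ} {ε : ℝ} (hCV : box p ε ⊆ V) {δ : ℝ} (hδ : 0 < δ) {u w : ℤ × ℤ}
    (hu : eg δ u ∈ box p ε) (hw : eg δ w ∈ box p ε) :
    Conn (fun a c => gs b (eg δ a) (eg δ c)) (Adj δ V) u w (gs b (eg δ u) (eg δ w)) := by
  have hC := convex_box p ε
  have h0 : Conn (fun a c => gs b (eg δ a) (eg δ c)) (Adj δ V) u u (gs b (eg δ u) (eg δ u)) := by
    rw [gs_self b (hCV hu)]; exact Conn.refl
  have hbet : ∀ a c i : ℤ, ∀ A B : ℝ, A < δ * a → δ * a < B → A < δ * c → δ * c < B →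
      (a ≤ i ∧ i ≤ c) ∨ (c ≤ i ∧ i ≤ a) → A < δ * i ∧ δ * i < B := by
    intro a c i A B h1 h2 h3 h4 h
    rcases h with ⟨h5, h6⟩ | ⟨h5, h6⟩
    · have h5 : (a : ℝ) ≤ i := by exact_mod_cast h5
      have h6 : (i : ℝ) ≤ c := by exact_mod_cast h6
      constructor <;> nlinarith
    · have h5 : (c : ℝ) ≤ i := by exact_mod_cast h5
      have h6 : (i : ℝ) ≤ a := by exact_mod_cast h6
      constructor <;> nlinarith
  have hmem : ∀ i j : ℤ, ((u.1 ≤ i ∧ i ≤ w.1) ∨ (w.1 ≤ i ∧ i ≤ u.1)) →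
      ((u.2 ≤ j ∧ j ≤ w.2) ∨ (w.2 ≤ j ∧ j ≤ u.2)) → eg δ (i, j) ∈ box p ε := by
    intro i j hi hj
    simp only [box, eg, Set.mem_ofPred_eq] at hu hw ⊢
    have a1 := hbet u.1 w.1 i _ _ hu.1 hu.2.1 hw.1 hw.2.1 hi
    have a2 := hbet u.2 w.2 j _ _ hu.2.2.1 hu.2.2.2 hw.2.2.1 hw.2.2.2 hj
    exact ⟨a1.1, a1.2, a2.1, a2.2⟩
  have h1 : Conn (fun a c => gs b (eg δ a) (eg δ c)) (Adj δ V) u (w.1, u.2)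
      (gs b (eg δ u) (eg δ (w.1, u.2))) := by
    rcases le_total u.1 w.1 with h | h
    · obtain ⟨n, hn⟩ := Int.le.dest h
      have := conn_line b hC hCV hu (1, 0) (by simp) u h0 n (by
        intro k hk; apply hmem <;> simp <;> omega)
      simpa [hn] using this
    · obtain ⟨n, hn⟩ := Int.le.dest h
      have := conn_line b hC hCV hu (-1, 0) (by simp) u h0 n (by
        intro k hk; apply hmem <;> simp <;> omega)
      simpa [← hn] using this
  rcases le_total u.2 w.2 with h | h
  · obtain ⟨n, hn⟩ := Int.le.dest h
    have := conn_line b hC hCV hu (0, 1) (by simp) (w.1, u.2) h1 n (by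
        intro k hk; apply hmem <;> simp <;> omega)
    simpa [hn] using this
  · obtain ⟨n, hn⟩ := Int.le.dest h
    have := conn_line b hC hCV hu (0, -1) (by simp) (w.1, u.2) h1 n (by
        intro k hk; apply hmem <;> simp <;> omega)
    simpa [← hn] using this

lemma conn_loop (hV : Full V) (hb : Bornology.IsBounded V) {δ : ℝ} (hδ : 0 < δ) {u : ℤ × ℤ}
    {x : FundamentalGroup V b}
    (h : Conn (fun a c => gs b (eg δ a) (eg δ c)) (Adj δ V) u u x) : x = 1 := by
  rcases h.exists_list with ⟨_, h⟩ | ⟨l, hl, rfl⟩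
  · exact h
  obtain ⟨R, hR⟩ := hb.exists_norm_le
  obtain ⟨B, hB⟩ := exists_nat_gt (2 * R / δ)
  refine hol_grid_eq_one _ (Adj δ V) B ?_ (fun _ _ h => h.symm) ?_ ?_ ?_ u l hl
  · intro a c h hle
    have := h.1
    unfold Nb at this
    simp only [Prod.ext_iff] at *
    omega
  · intro a c h
    show gs b _ _ * gs b _ _ = 1
    rw [gs_mul b (convex_segment (eg δ a) (eg δ c)) h.2 (left_mem_segment _ _ _)
      (right_mem_segment _ _ _) (left_mem_segment _ _ _), gs_self]
    exact h.2 (left_mem_segment _ _ _)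
  · intro a c h
    have h1 := hR _ (h.2 (left_mem_segment _ _ _))
    have h2 := (abs_le.1 ((Complex.abs_re_le_norm _).trans h1)).1
    have h3 := (abs_le.1 ((Complex.abs_im_le_norm _).trans h1)).1
    simp only [eg] at h2 h3
    rw [div_lt_iff₀ hδ] at hB
    have : (0:ℝ) < a.1 + a.2 + B := by
      by_contra hcon
      push Not at hcon
      nlinarith
    have : (0:ℤ) < a.1 + a.2 + B := by exact_mod_cast this
    exact this.le
  · intro v x y l hch hnot hmax hcase
    have hsq := square_sub hV hδ v x y l hch hnot hmax hcase
    have m1 : eg δ v ∈ csq δ v := by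
      simp only [csq, eg, Set.mem_ofPred_eq]; refine ⟨?_, ?_, ?_, ?_⟩ <;> push_cast <;> nlinarith
    have m2 : eg δ (v.1 - 1, v.2 - 1) ∈ csq δ v := by
      simp only [csq, eg, Set.mem_ofPred_eq]; refine ⟨?_, ?_, ?_, ?_⟩ <;> push_cast <;> nlinarith
    have m3 : eg δ (v.1 - 1, v.2) ∈ csq δ v := by
      simp only [csq, eg, Set.mem_ofPred_eq]; refine ⟨?_, ?_, ?_, ?_⟩ <;> push_cast <;> nlinarith
    have m4 : eg δ (v.1, v.2 - 1) ∈ csq δ v := by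
      simp only [csq, eg, Set.mem_ofPred_eq]; refine ⟨?_, ?_, ?_, ?_⟩ <;> push_cast <;> nlinarith
    have mx : eg δ x ∈ csq δ v := by rcases hcase with ⟨rfl, rfl⟩ | ⟨rfl, rfl⟩ <;> assumption
    have my : eg δ y ∈ csq δ v := by rcases hcase with ⟨rfl, rfl⟩ | ⟨rfl, rfl⟩ <;> assumption
    have hc := convex_csq δ v
    refine ⟨⟨?_, (hc.segment_subset m2 mx).trans hsq⟩, ⟨?_, (hc.segment_subset my m2).trans hsq⟩, ?_⟩
    · unfold Nb; rcases hcase with ⟨rfl, rfl⟩ | ⟨rfl, rfl⟩ <;> simp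
    · unfold Nb; rcases hcase with ⟨rfl, rfl⟩ | ⟨rfl, rfl⟩ <;> simp
    · show gs b _ _ * gs b _ _ = gs b _ _ * gs b _ _
      rw [gs_mul b hc hsq my m1 mx, gs_mul b hc hsq my m2 mx]
end Main
end NWD

namespace NWD
open Complex

lemma Ps_cast {V : Set ℂ} [PathConnectedSpace V] (b : V) {x y x' y' : V} (γ : Path x y)
    (hx : x' = x) (hy : y' = y) :
    Ps b (Path.Homotopic.Quotient.mk (γ.cast hx hy)) = Ps b (Path.Homotopic.Quotient.mk γ) := by
  subst hx; subst hy; rfl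

lemma box_sub_ball (p : ℂ) (ε : ℝ) : box p (ε / 2) ⊆ Metric.ball p ε := by
  intro z hz
  rw [Metric.mem_ball, dist_eq_norm]
  have := Complex.norm_le_abs_re_add_abs_im (z - p)
  obtain ⟨h1, h2, h3, h4⟩ := hz
  have a1 : |(z - p).re| < ε / 2 := by rw [abs_lt]; simp; constructor <;> linarith
  have a2 : |(z - p).im| < ε / 2 := by rw [abs_lt]; simp; constructor <;> linarith
  linarith

/-- lower left grid point -/
noncomputable def gp (δ : ℝ) (z : ℂ) : ℤ × ℤ := (⌊z.re / δ⌋, ⌊z.im / δ⌋)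

lemma gp_mem {δ : ℝ} (hδ : 0 < δ) {z p : ℂ} (h : dist z p < δ) : eg δ (gp δ z) ∈ box p (4 * δ) := by
  rw [dist_eq_norm] at h
  have h1 := abs_lt.1 ((Complex.abs_re_le_norm _).trans_lt h)
  have h2 := abs_lt.1 ((Complex.abs_im_le_norm _).trans_lt h)
  simp at h1 h2
  have a1 := Int.floor_le (z.re / δ)
  have a2 := Int.lt_floor_add_one (z.re / δ)
  have a3 := Int.floor_le (z.im / δ)
  have a4 := Int.lt_floor_add_one (z.im / δ)
  rw [le_div_iff₀ hδ] at a1 a3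
  rw [div_lt_iff₀ hδ] at a2 a4
  simp only [box, eg, gp, Set.mem_ofPred_eq]
  refine ⟨?_, ?_, ?_, ?_⟩ <;> nlinarith

theorem Full.simplyConnected {V : Set ℂ} (hV : Full V) (ho : IsOpen V) (hc : IsConnected V)
    (hb : Bornology.IsBounded V) : SimplyConnectedSpace V := by
  have hpc : PathConnectedSpace V := by
    rw [← isPathConnected_iff_pathConnectedSpace]
    exact ho.isConnected_iff_isPathConnected.1 hc
  rw [simply_connected_iff_loops_nullhomotopic]
  refine ⟨hpc, fun x γ => ?_⟩
  have hcont : Continuous (fun t => (γ t : ℂ)) := by fun_prop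
  obtain ⟨ε, hε, hεV⟩ := (isCompact_range hcont).exists_thickening_subset_open ho (by
    rintro _ ⟨t, rfl⟩; exact (γ t).2)
  have hbox : ∀ t, box (γ t : ℂ) (ε / 2) ⊆ V := fun t =>
    (box_sub_ball _ _).trans ((Metric.ball_subset_thickening (Set.mem_range_self (f := fun t => (γ t : ℂ)) t) ε).trans hεV)
  set δ := ε / 8 with hδ
  have hδ0 : 0 < δ := by positivity
  have h4 : 4 * δ = ε / 2 := by rw [hδ]; ring
  have huc := CompactSpace.uniformContinuous_of_continuous hcont
  rw [Metric.uniformContinuous_iff] at huc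
  obtain ⟨η, hη, huc⟩ := huc δ hδ0
  let Q : unitInterval → Prop := fun t => ∃ X,
    Conn (fun a c => gs x (eg δ a) (eg δ c)) (Adj δ V) (gp δ (γ 0)) (gp δ (γ t)) X ∧
    Ps x (Path.Homotopic.Quotient.mk (γ.subpath 0 t)) * gs x (γ t : ℂ) (eg δ (gp δ (γ t))) =
      gs x (γ 0 : ℂ) (eg δ (gp δ (γ 0))) * X
  have hQ0 : Q 0 := by
    refine ⟨1, Conn.refl, ?_⟩
    rw [Path.subpath_self, Path.Homotopic.Quotient.mk_refl]
    have : Ps x (Path.Homotopic.Quotient.refl (γ 0)) = 1 := by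
      have := Ps_trans x (Path.Homotopic.Quotient.refl (γ 0)) (Path.Homotopic.Quotient.refl (γ 0))
      rw [Path.Homotopic.Quotient.refl_trans] at this
      exact mul_eq_left.1 this.symm
    rw [this, one_mul, mul_one]
  have hstep : ∀ s t, dist s t < η → Q s → Q t := by
    rintro s t hst ⟨X, hX, hE⟩
    have hB := convex_box (γ s : ℂ) (4 * δ)
    have hBV : box (γ s : ℂ) (4 * δ) ⊆ V := by rw [h4]; exact hbox s
    have hself : (γ s : ℂ) ∈ box (γ s : ℂ) (4 * δ) := by
      simp only [box, Set.mem_ofPred_eq]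
      refine ⟨?_, ?_, ?_, ?_⟩ <;> linarith
    have hmem : ∀ r ∈ Set.uIcc s t, (γ r : ℂ) ∈ box (γ s : ℂ) (4 * δ) := by
      intro r hr
      have h1 : dist r s < η := by
        refine lt_of_le_of_lt ?_ hst
        rw [dist_comm s t]
        rw [Subtype.dist_eq, Subtype.dist_eq, Real.dist_eq, Real.dist_eq]
        rw [Set.mem_uIcc] at hr
        have : ((s:ℝ) ≤ r ∧ (r:ℝ) ≤ t) ∨ ((t:ℝ) ≤ r ∧ (r:ℝ) ≤ s) := hr
        rw [abs_le]
        rcases this with h | h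
        · constructor
          · linarith [abs_nonneg ((t:ℝ)-s)]
          · linarith [le_abs_self ((t:ℝ)-s)]
        · constructor
          · linarith [neg_abs_le ((t:ℝ)-s)]
          · linarith [abs_nonneg ((t:ℝ)-s)]
      have h2 := huc h1
      rw [dist_eq_norm] at h2
      have h3 := abs_lt.1 ((Complex.abs_re_le_norm _).trans_lt h2)
      have h4 := abs_lt.1 ((Complex.abs_im_le_norm _).trans_lt h2)
      simp at h3 h4
      simp only [box, Set.mem_ofPred_eq]
      refine ⟨?_, ?_, ?_, ?_⟩ <;> linarith
    have hgs : eg δ (gp δ (γ s)) ∈ box (γ s : ℂ) (4 * δ) := gp_mem hδ0 (by simpa using hδ0)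
    have hgt : eg δ (gp δ (γ t)) ∈ box (γ s : ℂ) (4 * δ) := gp_mem hδ0 (huc (by rwa [dist_comm]))
    have htm := hmem t Set.right_mem_uIcc
    refine ⟨X * gs x (eg δ (gp δ (γ s))) (eg δ (gp δ (γ t))), hX.trans (conn_box x hBV hδ0 hgs hgt), ?_⟩
    have e1 : Path.Homotopic.Quotient.mk (γ.subpath 0 t) =
        (Path.Homotopic.Quotient.mk (γ.subpath 0 s)).trans
          (Path.Homotopic.Quotient.mk (γ.subpath s t)) := by
      rw [← Path.Homotopic.Quotient.mk_trans, Path.Homotopic.Quotient.eq]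
      exact ⟨(Path.Homotopy.subpathTransSubpath γ 0 s t).symm⟩
    rw [e1, Ps_trans, Ps_eq_gs x hB hBV (γ.subpath s t) (by
      intro r
      have : γ.subpath s t r ∈ Set.range (γ.subpath s t) := ⟨r, rfl⟩
      rw [Path.range_subpath] at this
      obtain ⟨r', hr', he⟩ := this
      rw [← he]; exact hmem r' hr')]
    rw [mul_assoc, gs_mul x hB hBV hself htm hgt, ← gs_mul x hB hBV hself hgs hgt, ← mul_assoc, hE,
      mul_assoc]
  obtain ⟨n, hn⟩ := exists_nat_gt (1 / η)
  have hn0 : (0:ℝ) < n := lt_trans (by positivity) hn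
  have hall : ∀ k : ℕ, Q (Set.projIcc (0:ℝ) 1 zero_le_one (k / n)) := by
    intro k
    induction k with
    | zero => simpa [Set.projIcc_left] using hQ0
    | succ k ih =>
      refine hstep _ _ ?_ ih
      rw [Subtype.dist_eq, Real.dist_eq]
      refine lt_of_le_of_lt (Set.abs_projIcc_sub_projIcc zero_le_one) ?_
      have : (k:ℝ) / n - ((k+1 : ℕ) : ℝ) / n = - (1 / n) := by push_cast; ring
      rw [this, abs_neg, abs_of_pos (by positivity)]
      rw [div_lt_iff₀ hη] at hn
      rw [div_lt_iff₀ hn0]; linarith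
  have h1 := hall n
  rw [div_self hn0.ne', Set.projIcc_right] at h1
  obtain ⟨X, hX, hE⟩ := h1
  have e01 : γ (⟨1, Set.right_mem_Icc.2 zero_le_one⟩ : unitInterval) = γ 0 := by
    rw [γ.source]; exact γ.target
  rw [e01] at hX
  have hX1 := conn_loop x hV hb hδ0 hX
  have e03 : gs x (γ (⟨1, Set.right_mem_Icc.2 zero_le_one⟩ : unitInterval) : ℂ)
      (eg δ (gp δ (γ (⟨1, Set.right_mem_Icc.2 zero_le_one⟩ : unitInterval)))) =
      gs x (γ 0 : ℂ) (eg δ (gp δ (γ 0))) := by rw [e01]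
  rw [hX1, mul_one, e03] at hE
  have hE := mul_eq_right.1 hE
  have e2 := Path.subpath_zero_one γ
  have hE' : Ps x (Path.Homotopic.Quotient.mk (γ.subpath 0 1)) = 1 := hE
  rw [e2, Ps_cast] at hE'
  have := Ps_eq_one x hE'
  rw [← Path.Homotopic.Quotient.mk_refl, Path.Homotopic.Quotient.eq] at this
  exact this
end NWD

namespace NWD
open Complex Polynomial

/-- the polynomial map -/
def pf (p : Polynomial ℂ) : ℂ → ℂ := fun u => p.eval u

/-- the filled Julia set -/
def Kf (p : Polynomial ℂ) : Set ℂ :=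
  {w : ℂ | Bornology.IsBounded (Set.range fun n : ℕ => (pf p)^[n] w)}

lemma pf_diff (p : Polynomial ℂ) : Differentiable ℂ (pf p) := p.differentiable

lemma pf_iter_diff (p : Polynomial ℂ) (n : ℕ) : Differentiable ℂ ((pf p)^[n]) :=
  (pf_diff p).iterate n

lemma escape (p : Polynomial ℂ) (hdeg : 2 ≤ p.natDegree) :
    ∃ R : ℝ, 0 < R ∧ ∀ z : ℂ, R < ‖z‖ → 2 * ‖z‖ ≤ ‖pf p z‖ := by
  have hq : 0 < p.divX.degree := by
    rw [← natDegree_pos_iff_degree_pos, natDegree_divX_eq_natDegree_tsub_one]; omega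
  have h1 := p.divX.tendsto_norm_atTop hq (tendsto_norm_cobounded_atTop (E := ℂ))
  have h2 := h1.eventually (Filter.eventually_ge_atTop 3)
  have h3 := (tendsto_norm_cobounded_atTop (E := ℂ)).eventually (Filter.eventually_ge_atTop ‖p.coeff 0‖)
  have h4 := h2.and h3
  rw [Filter.Eventually] at h4
  have hb : Bornology.IsBounded {z : ℂ | 3 ≤ ‖p.divX.eval z‖ ∧ ‖p.coeff 0‖ ≤ ‖z‖}ᶜ := by
    rw [Bornology.isBounded_compl_iff]; exact h4
  obtain ⟨R, hR0, hR⟩ := hb.exists_pos_norm_le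
  refine ⟨R, hR0, fun z hz => ?_⟩
  have : z ∈ {z : ℂ | 3 ≤ ‖p.divX.eval z‖ ∧ ‖p.coeff 0‖ ≤ ‖z‖} := by
    by_contra hn
    exact absurd (hR z hn) (not_le.2 hz)
  obtain ⟨a1, a2⟩ := this
  have e : pf p z = p.divX.eval z * z + p.coeff 0 := by
    conv_lhs => rw [pf, ← p.divX_mul_X_add]
    simp
  rw [e]
  have := norm_sub_norm_le (p.divX.eval z * z) (-p.coeff 0)
  rw [sub_neg_eq_add, norm_neg, norm_mul] at this
  nlinarith [norm_nonneg z]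

lemma Kf_char (p : Polynomial ℂ) {R : ℝ} (hR : 0 < R)
    (h : ∀ z : ℂ, R < ‖z‖ → 2 * ‖z‖ ≤ ‖pf p z‖) (z : ℂ) :
    z ∈ Kf p ↔ ∀ n, ‖(pf p)^[n] z‖ ≤ R := by
  constructor
  · intro hz n
    by_contra hn
    push Not at hn
    have hgrow : ∀ k : ℕ, 2 ^ k * R < ‖(pf p)^[n + k] z‖ := by
      intro k
      induction k with
      | zero => simpa using hn
      | succ k ih =>
        have h1 : R < ‖(pf p)^[n + k] z‖ := lt_of_le_of_lt
          (le_mul_of_one_le_left hR.le (one_le_pow₀ (by norm_num))) ih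
        have h2 := h _ h1
        rw [← Function.iterate_succ_apply' (pf p)] at h2
        rw [pow_succ]
        have e : (n + (k + 1)) = (n + k).succ := by omega
        rw [e]
        linarith
    have hz' : Bornology.IsBounded (Set.range fun n : ℕ => (pf p)^[n] z) := hz
    obtain ⟨C, hC⟩ := hz'.exists_norm_le
    obtain ⟨k, hk⟩ := pow_unbounded_of_one_lt (C / R) (one_lt_two)
    rw [div_lt_iff₀ hR] at hk
    exact absurd (hC _ ⟨n + k, rfl⟩) (not_le.2 (hk.trans (hgrow k)))
  · intro hz
    refine (Metric.isBounded_closedBall (x := (0:ℂ)) (r := R)).subset ?_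
    rintro _ ⟨n, rfl⟩
    simpa using hz n

/-- a radius containing the filled Julia set -/
lemma exists_Kf_radius (p : Polynomial ℂ) (hdeg : 2 ≤ p.natDegree) :
    ∃ R : ℝ, 0 < R ∧ ∀ z, z ∈ Kf p ↔ ∀ n, ‖(pf p)^[n] z‖ ≤ R := by
  obtain ⟨R, hR, h⟩ := escape p hdeg
  exact ⟨R, hR, Kf_char p hR h⟩

lemma Kf_step (p : Polynomial ℂ) (z : ℂ) : pf p z ∈ Kf p ↔ z ∈ Kf p := by
  have e : (Set.range fun n : ℕ => (pf p)^[n] z) =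
      {z} ∪ Set.range fun n : ℕ => (pf p)^[n] (pf p z) := by
    ext w
    constructor
    · rintro ⟨n, rfl⟩
      cases n with
      | zero => left; rfl
      | succ n => right; exact ⟨n, rfl⟩
    · rintro (h | ⟨n, rfl⟩)
      · exact ⟨0, h.symm⟩
      · exact ⟨n + 1, rfl⟩
  show Bornology.IsBounded (Set.range fun n : ℕ => (pf p)^[n] (pf p z)) ↔
    Bornology.IsBounded (Set.range fun n : ℕ => (pf p)^[n] z)
  rw [e, Bornology.isBounded_union]
  simp

lemma pf_open (p : Polynomial ℂ) (hdeg : 2 ≤ p.natDegree) : IsOpenMap (pf p) :=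
  (p.isOpenQuotientMap_eval (by omega)).isOpenMap

lemma pf_int (p : Polynomial ℂ) (hdeg : 2 ≤ p.natDegree) {z : ℂ} (hz : z ∈ interior (Kf p)) :
    pf p z ∈ interior (Kf p) := by
  have : pf p '' interior (Kf p) ⊆ interior (Kf p) := by
    refine interior_maximal ?_ (pf_open p hdeg _ isOpen_interior)
    rintro _ ⟨w, hw, rfl⟩
    exact (Kf_step p w).2 (interior_subset hw)
  exact this ⟨z, hz, rfl⟩

lemma pf_iter_int (p : Polynomial ℂ) (hdeg : 2 ≤ p.natDegree) (n : ℕ) {z : ℂ} (hz : z ∈ interior (Kf p)) :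
    (pf p)^[n] z ∈ interior (Kf p) := by
  induction n with
  | zero => exact hz
  | succ n ih => rw [Function.iterate_succ_apply']; exact pf_int p hdeg ih

/-- Fatou component -/
def Uc (p : Polynomial ℂ) (z : ℂ) : Set ℂ := connectedComponentIn (interior (Kf p)) z

lemma pf_Uc (p : Polynomial ℂ) (hdeg : 2 ≤ p.natDegree) {z w : ℂ} (hz : z ∈ interior (Kf p))
    (hw : w ∈ Uc p z) : pf p w ∈ Uc p (pf p z) := by
  have h1 : IsPreconnected (pf p '' Uc p z) :=
    isPreconnected_connectedComponentIn.image _ (pf_diff p).continuous.continuousOn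
  refine h1.subset_connectedComponentIn ⟨z, mem_connectedComponentIn hz, rfl⟩ ?_ ⟨w, hw, rfl⟩
  rintro _ ⟨u, hu, rfl⟩
  exact pf_int p hdeg (connectedComponentIn_subset _ _ hu)

lemma pf_iter_Uc (p : Polynomial ℂ) (hdeg : 2 ≤ p.natDegree) (n : ℕ) {z w : ℂ}
    (hz : z ∈ interior (Kf p))
    (hw : w ∈ Uc p z) : (pf p)^[n] w ∈ Uc p ((pf p)^[n] z) := by
  induction n with
  | zero => exact hw
  | succ n ih =>
    rw [Function.iterate_succ_apply', Function.iterate_succ_apply']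
    exact pf_Uc p hdeg (pf_iter_int p hdeg n hz) ih

lemma full_Uc (p : Polynomial ℂ) (hdeg : 2 ≤ p.natDegree) (z : ℂ) : Full (Uc p z) := by
  intro W hWo hWc hWb hfr w hw
  obtain ⟨R, hR, hK⟩ := exists_Kf_radius p hdeg
  have hWK : W ⊆ interior (Kf p) := by
    refine interior_maximal ?_ hWo
    intro u hu
    rw [hK]
    intro n
    refine Complex.norm_le_of_forall_mem_frontier_norm_le hWb (pf_iter_diff p n).diffContOnCl ?_
      (subset_closure hu)
    intro x hx
    exact (hK x).1 (interior_subset (connectedComponentIn_subset _ _ (hfr hx))) n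
  obtain ⟨x, hx⟩ : (frontier W).Nonempty := by
    rw [nonempty_frontier_iff]
    refine ⟨⟨w, hw⟩, ?_⟩
    intro h
    rw [h] at hWb
    exact NormedSpace.unbounded_univ ℂ ℂ hWb
  have hop : IsOpen (Uc p z) := isOpen_interior.connectedComponentIn
  obtain ⟨y, hy1, hy2⟩ := mem_closure_iff_nhds.1 (frontier_subset_closure hx) _ (hop.mem_nhds (hfr hx))
  have := hWc.subset_connectedComponentIn hy2 hWK hw
  rw [Uc, connectedComponentIn_eq hy1]
  exact this

lemma simply_Uc (p : Polynomial ℂ) (hdeg : 2 ≤ p.natDegree) {z : ℂ} (hz : z ∈ interior (Kf p)) :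
    SimplyConnectedSpace (Uc p z) := by
  obtain ⟨R, hR, hK⟩ := exists_Kf_radius p hdeg
  refine (full_Uc p hdeg z).simplyConnected isOpen_interior.connectedComponentIn
    (isConnected_connectedComponentIn_iff.2 hz) ?_
  refine (Metric.isBounded_closedBall (x := (0:ℂ)) (r := R)).subset ?_
  intro w hw
  simpa using (hK w).1 (interior_subset (connectedComponentIn_subset _ _ hw)) 0

lemma inj_Uc (p : Polynomial ℂ) (hdeg : 2 ≤ p.natDegree) {z : ℂ} (hz : z ∈ interior (Kf p))
    (hcv : Disjoint (Uc p (pf p z)) (p.eval '' {k | p.derivative.eval k = 0})) :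
    Set.InjOn (pf p) (Uc p z) := by
  set V := Uc p (pf p z) with hVdef
  have hVo : IsOpen V := isOpen_interior.connectedComponentIn
  have hV : SimplyConnectedSpace V := simply_Uc p hdeg (pf_int p hdeg hz)
  have cov : IsCoveringMap (V.restrictPreimage (pf p)) :=
    ((p.isCoveringMapOn_eval).mono (fun x hx => Set.disjoint_left.1 hcv hx)).isCoveringMap_restrictPreimage
  have hlpc : LocallyPathConnectedSpace V := hVo.locallyPathConnectedSpace
  have hzV : pf p z ∈ V := mem_connectedComponentIn (pf_int p hdeg hz)
  let e0 : (pf p) ⁻¹' V := ⟨z, hzV⟩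
  obtain ⟨F, ⟨hF0, hF⟩, -⟩ := cov.existsUnique_continuousMap_lifts (ContinuousMap.id V)
    (⟨pf p z, hzV⟩ : V) e0 rfl
  have hpre : PreconnectedSpace (Uc p z) :=
    isPreconnected_iff_preconnectedSpace.1 isPreconnected_connectedComponentIn
  let i : Uc p z → (pf p) ⁻¹' V := fun u => ⟨u, pf_Uc p hdeg hz u.2⟩
  let r : Uc p z → V := fun u => ⟨pf p u, pf_Uc p hdeg hz u.2⟩
  have hi : Continuous i := by fun_prop
  have hr : Continuous r := by
    refine Continuous.subtype_mk ?_ _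
    exact (pf_diff p).continuous.comp continuous_subtype_val
  have key : F ∘ r = i := by
    refine cov.eq_of_comp_eq (F.continuous.comp hr) hi ?_ ⟨z, mem_connectedComponentIn hz⟩ ?_
    · rw [← Function.comp_assoc, hF]
      rfl
    · show F (r _) = i _
      exact hF0
  intro a ha b hb hab
  have h1 := congrFun key ⟨a, ha⟩
  have h2 := congrFun key ⟨b, hb⟩
  have h3 : r ⟨a, ha⟩ = r ⟨b, hb⟩ := Subtype.ext hab
  simp only [Function.comp_apply] at h1 h2
  rw [h3, h2] at h1
  exact (congrArg Subtype.val h1).symm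

end NWD

namespace NWD
open Complex Polynomial

lemma Uc_eq_of_mem (p : Polynomial ℂ) {x a b : ℂ} (ha : x ∈ Uc p a) (hb : x ∈ Uc p b) :
    Uc p a = Uc p b := by
  rw [Uc, Uc, connectedComponentIn_eq ha, connectedComponentIn_eq hb]

lemma crit_nonzero (p : Polynomial ℂ) (hdeg : 2 ≤ p.natDegree) : p.derivative ≠ 0 := by
  intro h
  have := natDegree_eq_zero_of_derivative_eq_zero h
  omega

lemma crit_finite (p : Polynomial ℂ) (hdeg : 2 ≤ p.natDegree) :
    {k | p.derivative.eval k = 0}.Finite := by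
  have := Polynomial.finite_setOf_isRoot (crit_nonzero p hdeg)
  exact this

lemma deriv_pf (p : Polynomial ℂ) (z : ℂ) : deriv (pf p) z = p.derivative.eval z :=
  p.deriv

lemma deriv_iter_succ (p : Polynomial ℂ) (n : ℕ) (z : ℂ) :
    deriv ((pf p)^[n + 1]) z = deriv (pf p) ((pf p)^[n] z) * deriv ((pf p)^[n]) z := by
  rw [Function.iterate_succ', deriv_comp]
  · exact pf_diff p _
  · exact pf_iter_diff p n _

lemma deriv_iter_add (p : Polynomial ℂ) (m n : ℕ) (z : ℂ) :
    deriv ((pf p)^[m + n]) z = deriv ((pf p)^[m]) ((pf p)^[n] z) * deriv ((pf p)^[n]) z := by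
  rw [Function.iterate_add, deriv_comp]
  · exact pf_iter_diff p m _
  · exact pf_iter_diff p n _

/-- reduction to a wandering component with univalent iterates -/
lemma wander_setup (p : Polynomial ℂ) (hdeg : 2 ≤ p.natDegree) {z : ℂ} (hz : z ∈ interior (Kf p))
    (H : ∀ n m, n < m → (pf p)^[m] z ∉ Uc p ((pf p)^[n] z)) :
    ∃ z0 ∈ interior (Kf p), (∀ n, Set.InjOn ((pf p)^[n]) (Uc p z0)) ∧
      (∀ n, ∀ w ∈ Uc p z0, deriv ((pf p)^[n]) w ≠ 0) ∧
      (∀ n m, n ≠ m → ∀ u ∈ Uc p z0, ∀ v ∈ Uc p z0, (pf p)^[n] u ≠ (pf p)^[m] v) := by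
  have hmem : ∀ n, (pf p)^[n] z ∈ Uc p ((pf p)^[n] z) := fun n =>
    mem_connectedComponentIn (pf_iter_int p hdeg n hz)
  have hdis : ∀ n m, n ≠ m → ∀ x, x ∈ Uc p ((pf p)^[n] z) → x ∉ Uc p ((pf p)^[m] z) := by
    intro n m hnm x h1 h2
    have e := Uc_eq_of_mem p h1 h2
    rcases lt_or_gt_of_ne hnm with h | h
    · exact H n m h (e ▸ hmem m)
    · exact H m n h (e ▸ hmem n)
  have hfin : (p.eval '' {k | p.derivative.eval k = 0}).Finite := (crit_finite p hdeg).image _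
  have hbad : {n : ℕ | ∃ x ∈ p.eval '' {k | p.derivative.eval k = 0}, x ∈ Uc p ((pf p)^[n] z)}.Finite := by
    have : ∀ x ∈ p.eval '' {k | p.derivative.eval k = 0}, {n : ℕ | x ∈ Uc p ((pf p)^[n] z)}.Finite := by
      intro x _
      refine Set.Subsingleton.finite ?_
      intro n hn m hm
      by_contra hnm
      exact hdis n m hnm x hn hm
    refine (hfin.biUnion this).subset ?_
    rintro n ⟨x, hx, hxn⟩
    exact Set.mem_biUnion hx hxn
  obtain ⟨N, hN⟩ := hbad.bddAbove
  have hgood : ∀ n, N ≤ n → Disjoint (Uc p ((pf p)^[n + 1] z)) (p.eval '' {k | p.derivative.eval k = 0}) := by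
    intro n hn
    rw [Set.disjoint_left]
    intro x hx1 hx2
    have := hN (show n + 1 ∈ _ from ⟨x, hx2, hx1⟩)
    omega
  have hinj : ∀ n, N ≤ n → Set.InjOn (pf p) (Uc p ((pf p)^[n] z)) := by
    intro n hn
    refine inj_Uc p hdeg (pf_iter_int p hdeg n hz) ?_
    have := hgood n hn
    rwa [Function.iterate_succ_apply'] at this
  have hder : ∀ n, N ≤ n → ∀ w ∈ Uc p ((pf p)^[n] z), deriv (pf p) w ≠ 0 := by
    intro n hn w hw h0
    have h1 := pf_Uc p hdeg (pf_iter_int p hdeg n hz) hw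
    rw [← Function.iterate_succ_apply' (pf p)] at h1
    rw [deriv_pf] at h0
    exact Set.disjoint_left.1 (hgood n hn) h1 ⟨w, h0, rfl⟩
  have hzN := pf_iter_int p hdeg N hz
  have hin : ∀ n, ∀ w ∈ Uc p ((pf p)^[N] z), (pf p)^[n] w ∈ Uc p ((pf p)^[n + N] z) := by
    intro n w hw
    rw [Function.iterate_add_apply]
    exact pf_iter_Uc p hdeg n hzN hw
  refine ⟨(pf p)^[N] z, hzN, ?_, ?_, ?_⟩
  · intro n
    induction n with
    | zero => exact Set.injOn_id _
    | succ n ih =>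
      rw [Function.iterate_succ']
      exact (hinj (n + N) (by omega)).comp ih (fun w hw => hin n w hw)
  · intro n
    induction n with
    | zero => intro w _; simp
    | succ n ih =>
      intro w hw
      rw [deriv_iter_succ]
      exact mul_ne_zero (hder (n + N) (by omega) _ (hin n w hw)) (ih w hw)
  · intro n m hnm u hu v hv h
    refine hdis (n + N) (m + N) (by omega) ((pf p)^[n] u) (hin n u hu) ?_
    rw [h]; exact hin m v hv

end NWD

namespace NWD
open Complex MeasureTheory

/-- truncated singular kernel -/
noncomputable def kap (ε : ℝ) (y : ℝ) : ℝ := if y < ε then y⁻¹ else 0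

lemma kap_nonneg (ε : ℝ) {y : ℝ} (hy : 0 ≤ y) : 0 ≤ kap ε y := by
  unfold kap; split_ifs <;> positivity

lemma kap_meas (ε : ℝ) : Measurable (kap ε) := by
  unfold kap
  exact Measurable.ite measurableSet_Iio measurable_inv measurable_const

lemma kap_aux (ε : ℝ) (y : ℝ) (hy : y ∈ Set.Ioi (0:ℝ)) :
    y ^ (Module.finrank ℝ ℂ - 1) • kap ε y = (Set.Iio ε).indicator (fun _ => (1:ℝ)) y := by
  have hy' : (0:ℝ) < y := hy
  rw [Complex.finrank_real_complex]
  unfold kap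
  by_cases h : y < ε
  · simp [h, hy'.ne']
  · simp [h]

lemma kap_integrable (ε : ℝ) : Integrable (fun u : ℂ => kap ε ‖u‖) := by
  rw [integrable_fun_norm_addHaar volume (f := kap ε)]
  rw [integrableOn_congr_fun (fun y hy => kap_aux ε y hy) measurableSet_Ioi]
  rw [IntegrableOn, integrable_indicator_iff measurableSet_Iio]
  refine integrableOn_const ?_
  rw [Measure.restrict_apply measurableSet_Iio]
  refine ne_of_lt (lt_of_le_of_lt (measure_mono (t := Set.Icc 0 ε) ?_) measure_Icc_lt_top)
  rintro x ⟨h1, h2⟩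
  exact ⟨le_of_lt h2, le_of_lt h1⟩

lemma kap_integral {ε : ℝ} (hε : 0 ≤ ε) :
    ∫ u : ℂ, kap ε ‖u‖ = (2 * (volume : Measure ℂ).real (Metric.ball 0 1)) * ε := by
  rw [integral_fun_norm_addHaar volume (kap ε)]
  rw [setIntegral_congr_fun measurableSet_Ioi (fun y hy => kap_aux ε y hy)]
  rw [setIntegral_indicator measurableSet_Iio, Complex.finrank_real_complex]
  have : Set.Ioi (0:ℝ) ∩ Set.Iio ε = Set.Ioo 0 ε := rfl
  rw [this]
  simp [hε]
  ring

/-- bounded measurable with bounded support -/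
structure Good (μ : ℂ → ℂ) (M R : ℝ) : Prop where
  meas : Measurable μ
  bd : ∀ w, ‖μ w‖ ≤ M
  supp : ∀ w, R < ‖w‖ → μ w = 0

/-- Cauchy transform -/
noncomputable def CT (μ : ℂ → ℂ) (z : ℂ) : ℂ := ∫ w, μ w * (w - z)⁻¹

variable {μ : ℂ → ℂ} {M R : ℝ}

lemma Good.Mnn (h : Good μ M R) : 0 ≤ M := (norm_nonneg _).trans (h.bd 0)

/-- dominating function -/
noncomputable def dom (M R : ℝ) (z w : ℂ) : ℝ :=
  M * (kap 1 ‖w - z‖ + (Metric.closedBall (0:ℂ) R).indicator (fun _ => (1:ℝ)) w)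

lemma ind_integrable (R : ℝ) :
    Integrable ((Metric.closedBall (0:ℂ) R).indicator (fun _ => (1:ℝ))) := by
  rw [integrable_indicator_iff Metric.isClosed_closedBall.measurableSet]
  exact integrableOn_const (isCompact_closedBall _ _).measure_lt_top.ne

lemma dom_integrable (M R : ℝ) (z : ℂ) : Integrable (dom M R z) :=
  (((kap_integrable 1).comp_sub_right z).add (ind_integrable R)).const_mul M

lemma Good.le_dom (h : Good μ M R) (z w : ℂ) : ‖μ w * (w - z)⁻¹‖ ≤ dom M R z w := by
  have hM := h.Mnn
  have hk := kap_nonneg 1 (norm_nonneg (w - z))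
  by_cases hw : R < ‖w‖
  · rw [h.supp w hw]
    simp only [zero_mul, norm_zero]
    refine mul_nonneg hM (add_nonneg hk (Set.indicator_nonneg (fun _ _ => zero_le_one) _))
  · push Not at hw
    have hi : (Metric.closedBall (0:ℂ) R).indicator (fun _ => (1:ℝ)) w = 1 :=
      Set.indicator_of_mem (by simpa using hw) _
    rw [norm_mul, dom, hi]
    refine mul_le_mul (h.bd w) ?_ (norm_nonneg _) hM
    rw [norm_inv]
    unfold kap at hk ⊢
    split_ifs with h1
    · linarith
    · push Not at h1
      have := inv_le_one_of_one_le₀ h1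
      linarith

lemma Good.integrable (h : Good μ M R) (z : ℂ) : Integrable (fun w => μ w * (w - z)⁻¹) := by
  refine (dom_integrable M R z).mono' ?_ (Filter.Eventually.of_forall (h.le_dom z))
  exact (h.meas.mul ((measurable_id.sub_const z).inv)).aestronglyMeasurable

lemma Good.integrable0 (h : Good μ M R) : Integrable μ := by
  refine ((ind_integrable R).const_mul M).mono' h.meas.aestronglyMeasurable
    (Filter.Eventually.of_forall fun w => ?_)
  by_cases hw : R < ‖w‖
  · rw [h.supp w hw, norm_zero]
    exact mul_nonneg h.Mnn (Set.indicator_nonneg (fun _ _ => zero_le_one) _)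
  · push Not at hw
    rw [Set.indicator_of_mem (by simpa using hw), mul_one]
    exact h.bd w

lemma Good.CT_bdd (h : Good μ M R) : ∃ C, 0 ≤ C ∧ ∀ z, ‖CT μ z‖ ≤ C := by
  have key : ∀ z, ‖CT μ z‖ ≤ M * ((∫ u : ℂ, kap 1 ‖u‖) +
      ∫ w, (Metric.closedBall (0:ℂ) R).indicator (fun _ => (1:ℝ)) w) := by
    intro z
    refine (norm_integral_le_of_norm_le (dom_integrable M R z)
      (Filter.Eventually.of_forall (h.le_dom z))).trans ?_
    unfold dom
    rw [integral_const_mul, integral_add ((kap_integrable 1).comp_sub_right z) (ind_integrable R),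
      integral_sub_right_eq_self (fun w : ℂ => kap 1 ‖w‖)]
  exact ⟨_, (norm_nonneg _).trans (key 0), key⟩

lemma Good.CT_tendsto (h : Good μ M R) :
    Filter.Tendsto (CT μ) (Filter.cocompact ℂ) (nhds 0) := by
  have hb : ∀ z : ℂ, R < ‖z‖ → ‖CT μ z‖ ≤ (∫ w, ‖μ w‖) * (‖z‖ - R)⁻¹ := by
    intro z hz
    rw [← integral_mul_const]
    refine norm_integral_le_of_norm_le (h.integrable0.norm.mul_const _) ?_
    refine Filter.Eventually.of_forall fun w => ?_
    by_cases hw : R < ‖w‖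
    · simp [h.supp w hw]
    · push Not at hw
      rw [norm_mul, norm_inv]
      refine mul_le_mul_of_nonneg_left ?_ (norm_nonneg _)
      refine inv_anti₀ (by linarith) ?_
      have := norm_sub_norm_le z w
      rw [norm_sub_rev] at this
      linarith
  have h1 : Filter.Tendsto (fun z : ℂ => (∫ w, ‖μ w‖) * (‖z‖ - R)⁻¹) (Filter.cocompact ℂ) (nhds 0) := by
    rw [← mul_zero (∫ w, ‖μ w‖)]
    refine Filter.Tendsto.const_mul _ ?_
    refine Filter.Tendsto.comp tendsto_inv_atTop_zero ?_
    exact Filter.tendsto_atTop_add_const_right _ (-R) (tendsto_norm_cocompact_atTop (E := ℂ))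
  refine squeeze_zero_norm' ?_ h1
  filter_upwards [(tendsto_norm_cocompact_atTop (E := ℂ)).eventually (Filter.eventually_gt_atTop R)] with z hz
  exact hb z hz

/-- regularised kernel -/
noncomputable def ker (ε : ℝ) (u : ℂ) : ℂ := (starRingEnd ℂ) u / (((max ‖u‖ ε) ^ 2 : ℝ) : ℂ)

lemma ker_cont {ε : ℝ} (hε : 0 < ε) : Continuous (ker ε) := by
  unfold ker
  refine Continuous.div (by fun_prop) (by fun_prop) ?_
  intro u
  have : 0 < max ‖u‖ ε := lt_max_of_lt_right hε
  exact_mod_cast (pow_pos this 2).ne'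

lemma ker_bd {ε : ℝ} (hε : 0 < ε) (u : ℂ) : ‖ker ε u‖ ≤ ε⁻¹ := by
  have h1 : 0 < max ‖u‖ ε := lt_max_of_lt_right hε
  rw [ker, norm_div, Complex.norm_real, RCLike.norm_conj, Real.norm_of_nonneg (by positivity),
    div_le_iff₀ (by positivity), sq, ← mul_assoc]
  have h2 : ε ≤ max ‖u‖ ε := le_max_right _ _
  have h3 : ‖u‖ ≤ max ‖u‖ ε := le_max_left _ _
  have h4 : 1 ≤ ε⁻¹ * max ‖u‖ ε := by
    rw [← inv_mul_cancel₀ hε.ne']; gcongr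
  nlinarith

lemma ker_diff {ε : ℝ} (hε : 0 < ε) (u : ℂ) : ‖u⁻¹ - ker ε u‖ ≤ kap ε ‖u‖ := by
  by_cases hu : u = 0
  · subst hu; simp [ker, kap, hε]
  have hu' : 0 < ‖u‖ := norm_pos_iff.2 hu
  unfold ker kap
  have hinv : u⁻¹ = (starRingEnd ℂ) u / ((‖u‖ ^ 2 : ℝ) : ℂ) := by
    rw [Complex.inv_def, Complex.normSq_eq_norm_sq, div_eq_mul_inv]
    push_cast; rfl
  split_ifs with h
  · rw [max_eq_right h.le]
    have e : u⁻¹ - (starRingEnd ℂ) u / ((ε ^ 2 : ℝ) : ℂ) =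
        u⁻¹ * ((1 - ‖u‖ ^ 2 / ε ^ 2 : ℝ) : ℂ) := by
      rw [hinv]
      have : (‖u‖ : ℂ) ≠ 0 := by exact_mod_cast hu'.ne'
      have : (ε : ℂ) ≠ 0 := by exact_mod_cast hε.ne'
      push_cast
      field_simp
    rw [e, norm_mul, norm_inv, Complex.norm_real]
    refine mul_le_of_le_one_right (by positivity) ?_
    have h1 : ‖u‖ ^ 2 / ε ^ 2 ≤ 1 := by
      rw [div_le_one (by positivity)]; gcongr
    have h2 : 0 ≤ ‖u‖ ^ 2 / ε ^ 2 := by positivity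
    rw [Real.norm_eq_abs, abs_le]; constructor <;> linarith
  · push Not at h
    rw [max_eq_left h, hinv]
    simp

lemma Good.CT_cont (h : Good μ M R) : Continuous (CT μ) := by
  have hM := h.Mnn
  set V : ℝ := (2 * (volume : Measure ℂ).real (Metric.ball 0 1)) with hV
  have hV0 : 0 ≤ V := by positivity
  have hkint : ∀ ε, 0 < ε → ∀ z, Integrable (fun w => μ w * ker ε (w - z)) := by
    intro ε hε z
    refine (h.integrable0.norm.mul_const ε⁻¹).mono' ?_ (Filter.Eventually.of_forall fun w => ?_)
    · exact (h.meas.mul ((ker_cont hε).measurable.comp (measurable_id.sub_const z))).aestronglyMeasurable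
    · rw [norm_mul]; exact mul_le_mul_of_nonneg_left (ker_bd hε _) (norm_nonneg _)
  have hc : ∀ ε, 0 < ε → Continuous (fun z => ∫ w, μ w * ker ε (w - z)) := by
    intro ε hε
    refine continuous_of_dominated (bound := fun w => ‖μ w‖ * ε⁻¹) ?_ ?_ ?_ ?_
    · intro z; exact (hkint ε hε z).aestronglyMeasurable
    · intro z
      refine Filter.Eventually.of_forall fun w => ?_
      rw [norm_mul]; exact mul_le_mul_of_nonneg_left (ker_bd hε _) (norm_nonneg _)
    · exact h.integrable0.norm.mul_const _
    · refine Filter.Eventually.of_forall fun w => ?_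
      exact continuous_const.mul ((ker_cont hε).comp (continuous_const.sub continuous_id))
  have hd : ∀ ε, 0 < ε → ∀ z, dist (CT μ z) (∫ w, μ w * ker ε (w - z)) ≤ M * (V * ε) := by
    intro ε hε z
    rw [dist_eq_norm, CT, ← integral_sub (h.integrable z) (hkint ε hε z), hV, ← kap_integral hε.le,
      ← integral_sub_right_eq_self (fun w : ℂ => kap ε ‖w‖) z, ← integral_const_mul]
    refine norm_integral_le_of_norm_le (((kap_integrable ε).comp_sub_right z).const_mul M) ?_
    refine Filter.Eventually.of_forall fun w => ?_
    rw [← mul_sub, norm_mul]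
    exact mul_le_mul (h.bd w) (ker_diff hε _) (norm_nonneg _) hM
  have hε : ∀ n : ℕ, (0:ℝ) < 1 / ((n:ℝ) + 1) := fun n => by positivity
  have hu : TendstoUniformly (fun (n : ℕ) z => ∫ w, μ w * ker (1 / ((n:ℝ) + 1)) (w - z)) (CT μ)
      Filter.atTop := by
    rw [Metric.tendstoUniformly_iff]
    intro δ hδ
    have ht : Filter.Tendsto (fun n : ℕ => M * (V * (1 / ((n:ℝ) + 1)))) Filter.atTop (nhds 0) := by
      have := (tendsto_one_div_add_atTop_nhds_zero_nat (𝕜 := ℝ)).const_mul V |>.const_mul M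
      simpa using this
    filter_upwards [ht.eventually (gt_mem_nhds hδ)] with n hn z
    exact lt_of_le_of_lt (hd _ (hε n) z) hn
  exact hu.continuous (Filter.Frequently.of_forall fun n => hc _ (hε n))

/-- holomorphic parameter integrals -/
lemma hol_param {X : Type*} [MeasurableSpace X] {ν : Measure X} (F : ℂ → X → ℂ) (z0 : ℂ) {s : ℝ}
    (hs : 0 < s) (g : X → ℝ) (hg : Integrable g ν)
    (hm : ∀ z ∈ Metric.ball z0 s, AEStronglyMeasurable (F z) ν)
    (hd : ∀ᵐ x ∂ν, DifferentiableOn ℂ (fun z => F z x) (Metric.ball z0 s))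
    (hb : ∀ᵐ x ∂ν, ∀ z ∈ Metric.ball z0 s, ‖F z x‖ ≤ g x) :
    DifferentiableAt ℂ (fun z => ∫ x, F z x ∂ν) z0 := by
  have hz0 : z0 ∈ Metric.ball z0 s := Metric.mem_ball_self hs
  have hda : ∀ᵐ x ∂ν, ∀ z ∈ Metric.ball z0 s, DifferentiableAt ℂ (fun z => F z x) z := by
    filter_upwards [hd] with x hx z hz
    exact hx.differentiableAt (Metric.isOpen_ball.mem_nhds hz)
  have := hasDerivAt_integral_of_dominated_loc_of_deriv_le (μ := ν) (F := F) (x₀ := z0)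
    (s := Metric.ball z0 (s / 2)) (bound := fun x => g x / (s / 3))
    (F' := fun z x => deriv (fun z => F z x) z) (Metric.ball_mem_nhds _ (by positivity)) ?_ ?_ ?_ ?_ ?_ ?_
  · exact this.2.differentiableAt
  · filter_upwards [Metric.ball_mem_nhds z0 hs] with z hz using hm z hz
  · exact hg.mono' (hm z0 hz0) (hb.mono fun x hx => hx z0 hz0)
  · let t : ℕ → ℂ := fun n => ((s / ((n:ℝ) + 2) : ℝ) : ℂ)
    have ht0 : ∀ n, t n ≠ 0 := fun n => by
      have : s / ((n:ℝ) + 2) ≠ 0 := by positivity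
      exact Complex.ofReal_ne_zero.2 this
    have htn : ∀ n, ‖t n‖ < s := fun n => by
      rw [Complex.norm_real, Real.norm_of_nonneg (by positivity), div_lt_iff₀ (by positivity)]
      have : (0:ℝ) ≤ n := by positivity
      nlinarith
    have httend : Filter.Tendsto t Filter.atTop (nhds 0) := by
      have : Filter.Tendsto (fun n : ℕ => s / ((n:ℝ) + 2)) Filter.atTop (nhds 0) := by
        refine Filter.Tendsto.div_atTop tendsto_const_nhds ?_
        exact Filter.tendsto_atTop_add_const_right _ _ tendsto_natCast_atTop_atTop
      have := (Complex.continuous_ofReal.tendsto 0).comp this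
      rw [Complex.ofReal_zero] at this
      exact this
    refine aestronglyMeasurable_of_tendsto_ae (f := fun n x => (t n)⁻¹ • (F (z0 + t n) x - F z0 x))
      Filter.atTop ?_ ?_
    · intro n
      have h1 : z0 + t n ∈ Metric.ball z0 s := by simpa using htn n
      exact AEStronglyMeasurable.const_smul ((hm _ h1).sub (hm _ hz0)) ((t n)⁻¹)
    · filter_upwards [hda] with x hx
      have := (hx z0 hz0).hasDerivAt.tendsto_slope_zero
      refine this.comp ?_
      rw [tendsto_nhdsWithin_iff]
      exact ⟨httend, Filter.Eventually.of_forall fun n => ht0 n⟩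
  · filter_upwards [hda, hb] with x hx1 hx2 z hz
    rw [Metric.mem_ball] at hz
    have hsub : Metric.closedBall z (s / 3) ⊆ Metric.ball z0 s := by
      intro y hy
      rw [Metric.mem_closedBall] at hy
      rw [Metric.mem_ball]
      have := dist_triangle y z z0
      linarith
    refine norm_deriv_le_of_forall_mem_sphere_norm_le (by positivity) ?_ ?_
    · refine DifferentiableOn.diffContOnCl ?_
      intro y hy
      rw [closure_ball _ (by positivity)] at hy
      exact (hx1 y (hsub hy)).differentiableWithinAt
    · intro y hy
      exact hx2 y (hsub (Metric.sphere_subset_closedBall hy))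
  · exact hg.div_const _
  · filter_upwards [hda] with x hx z hz
    refine (hx z ?_).hasDerivAt
    exact Metric.ball_subset_ball (by linarith) hz

lemma Good.CT_diff (h : Good μ M R) {z0 : ℂ} (hz : ∀ᶠ w in nhds z0, μ w = 0) :
    DifferentiableAt ℂ (CT μ) z0 := by
  obtain ⟨s, hs, hs'⟩ := Metric.eventually_nhds_iff_ball.1 hz
  refine hol_param (fun z w => μ w * (w - z)⁻¹) z0 (s := s / 2) (by positivity)
    (fun w => ‖μ w‖ * (s / 2)⁻¹) (h.integrable0.norm.mul_const _) ?_ ?_ ?_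
  · intro z _; exact (h.integrable z).aestronglyMeasurable
  · refine Filter.Eventually.of_forall fun w => ?_
    by_cases hw : w ∈ Metric.ball z0 s
    · simp only [hs' w hw, zero_mul]; exact differentiableOn_const _
    · intro z hz
      refine (DifferentiableAt.const_mul (DifferentiableAt.inv (by fun_prop) ?_) _).differentiableWithinAt
      intro h0
      rw [sub_eq_zero] at h0
      rw [h0] at hw
      exact hw (Metric.ball_subset_ball (by linarith) hz)
  · refine Filter.Eventually.of_forall fun w z hz => ?_
    by_cases hw : w ∈ Metric.ball z0 s
    · simp [hs' w hw]
    · rw [norm_mul, norm_inv]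
      refine mul_le_mul_of_nonneg_left (inv_anti₀ (by positivity) ?_) (norm_nonneg _)
      rw [Metric.mem_ball] at hw hz
      have := dist_triangle w z z0
      rw [← dist_eq_norm]; linarith

lemma Good.indicator (h : Good μ M R) {S : Set ℂ} (hS : MeasurableSet S) :
    Good (S.indicator μ) M R := by
  refine ⟨h.meas.indicator hS, fun w => ?_, fun w hw => ?_⟩
  · exact (norm_indicator_le_norm_self _ _).trans (h.bd w)
  · by_cases hw' : w ∈ S
    · rw [Set.indicator_of_mem hw', h.supp w hw]
    · rw [Set.indicator_of_notMem hw']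

lemma Good.CT_split (h : Good μ M R) {S : Set ℂ} (hS : MeasurableSet S) (z : ℂ) :
    CT μ z = CT (S.indicator μ) z + CT (Sᶜ.indicator μ) z := by
  unfold CT
  rw [← integral_add ((h.indicator hS).integrable z) ((h.indicator hS.compl).integrable z)]
  congr 1; ext w
  rw [← add_mul, Set.indicator_self_add_compl_apply]

end NWD

namespace NWD
open Complex MeasureTheory Polynomial

lemma evalEval_eq_map (Q : ℂ[X][X]) (x y : ℂ) :
    Q.evalEval x y = (Q.map (evalRingHom x)).eval y := by
  rw [evalEval]
  have := Polynomial.hom_eval₂ Q (RingHom.id ℂ[X]) (evalRingHom x) (C y)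
  rw [RingHom.comp_id] at this
  rw [eval_map]
  simp only [coe_evalRingHom, eval_C] at this
  exact this

lemma eval_eval_X (Q : ℂ[X][X]) (x : ℂ) : (Q.eval X).eval x = Q.evalEval x x := by
  rw [evalEval_eq_map, eval_map]
  have := Polynomial.hom_eval₂ Q (RingHom.id ℂ[X]) (evalRingHom x) X
  rw [RingHom.comp_id] at this
  simp only [coe_evalRingHom, eval_X] at this
  exact this

lemma biv_div (Q : ℂ[X][X]) (h : ∀ x, Q.evalEval x x = 0) :
    ∃ S : ℂ[X][X], ∀ x y, Q.evalEval x y = (y - x) * S.evalEval x y := by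
  have h0 : Q.eval X = 0 := by
    refine Polynomial.funext fun x => ?_
    rw [eval_eval_X, h, eval_zero]
  obtain ⟨S, hS⟩ := Polynomial.dvd_iff_isRoot.2 (show Q.IsRoot X from h0)
  refine ⟨S, fun x y => ?_⟩
  rw [hS, evalEval_mul, evalEval_sub, evalEval_C, evalEval_X, eval_X]

lemma biv_cont (Q : ℂ[X][X]) : Continuous (fun q : ℂ × ℂ => Q.evalEval q.1 q.2) := by
  induction Q using Polynomial.induction_on' with
  | add a b ha hb => simp only [evalEval_add]; exact ha.add hb
  | monomial n a =>
    have : (fun q : ℂ × ℂ => (monomial n a).evalEval q.1 q.2) = fun q => a.eval q.1 * q.2 ^ n := by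
      ext q; simp [evalEval]
    rw [this]
    exact (a.continuous.comp continuous_fst).mul (continuous_snd.pow n)

lemma biv_diff (Q : ℂ[X][X]) (x : ℂ) : Differentiable ℂ (fun y => Q.evalEval x y) := by
  simp_rw [evalEval_eq_map]
  exact Polynomial.differentiable _

lemma biv_exists (p : ℂ[X]) : ∃ P E : ℂ[X][X],
    (∀ u z, pf p z - pf p u = (z - u) * P.evalEval u z) ∧
    (∀ z, P.evalEval z z = deriv (pf p) z) ∧
    (∀ u z, deriv (pf p) u ^ 2 - deriv (pf p) z * P.evalEval u z = (u - z) * E.evalEval u z) := by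
  obtain ⟨P, hP⟩ := biv_div (p.map C - C p) (fun x => by
    rw [evalEval_sub, evalEval_map_C, evalEval_C, sub_self])
  have h1 : ∀ u z, pf p z - pf p u = (z - u) * P.evalEval u z := by
    intro u z
    rw [← hP, evalEval_sub, evalEval_map_C, evalEval_C]; rfl
  have h2 : ∀ z, P.evalEval z z = deriv (pf p) z := by
    intro z
    have hd : HasDerivAt (pf p) (P.evalEval z z) z := by
      rw [hasDerivAt_iff_tendsto_slope]
      have hc : Filter.Tendsto (fun y => P.evalEval z y) (nhdsWithin z {z}ᶜ) (nhds (P.evalEval z z)) :=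
        ((biv_diff P z).continuous.tendsto z).mono_left nhdsWithin_le_nhds
      refine hc.congr' ?_
      filter_upwards [self_mem_nhdsWithin] with y hy
      have hy' : y - z ≠ 0 := sub_ne_zero.2 hy
      rw [slope_def_field, h1]
      field_simp
    exact hd.deriv.symm
  obtain ⟨E, hE⟩ := biv_div (C (p.derivative ^ 2) - p.derivative.map C * P) (fun x => by
    rw [evalEval_sub, evalEval_mul, evalEval_map_C, evalEval_C, h2, deriv_pf]; simp; ring)
  refine ⟨P, -E, h1, h2, fun u z => ?_⟩
  have e : (u - z) * (-E).evalEval u z = (z - u) * E.evalEval u z := by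
    rw [evalEval_neg]; ring
  rw [e, ← hE, evalEval_sub, evalEval_mul, evalEval_map_C, evalEval_C, deriv_pf, deriv_pf]; simp

lemma det_real (c : ℂ) :
    ((ContinuousLinearMap.toSpanSingleton ℂ c).restrictScalars ℝ).det = normSq c := by
  rw [ContinuousLinearMap.det]
  have : ((((ContinuousLinearMap.toSpanSingleton ℂ c).restrictScalars ℝ) : ℂ →L[ℝ] ℂ) : ℂ →ₗ[ℝ] ℂ) =
      Algebra.lmul ℝ ℂ c := by
    ext x
    simp [mul_comm]
  rw [this, ← Algebra.norm_complex_apply]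
  rfl

lemma hasFDeriv_pf (p : ℂ[X]) (s : Set ℂ) (u : ℂ) : HasFDerivWithinAt (pf p)
    ((ContinuousLinearMap.toSpanSingleton ℂ (deriv (pf p) u)).restrictScalars ℝ) s u :=
  (((pf_diff p u).hasDerivAt.hasFDerivAt).restrictScalars ℝ).hasFDerivWithinAt

lemma h_diff (p : ℂ[X]) (hdeg : 2 ≤ p.natDegree) {μ : ℂ → ℂ} {M R : ℝ} (hμ : Good μ M R)
    (inv : ∀ u, deriv (pf p) u ≠ 0 →
      μ (pf p u) * (starRingEnd ℂ) (deriv (pf p) u) = deriv (pf p) u * μ u)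
    {z0 : ℂ} (hz0 : deriv (pf p) z0 ≠ 0) :
    DifferentiableAt ℂ (fun z => CT μ (pf p z) - deriv (pf p) z * CT μ z) z0 := by
  obtain ⟨P, E, hP, hPd, hE⟩ := biv_exists p
  have hPc := biv_cont P
  have hEc := biv_cont E
  obtain ⟨s, hs, hPs⟩ : ∃ s > 0, ∀ u ∈ Metric.closedBall z0 s, ∀ z ∈ Metric.closedBall z0 s,
      P.evalEval u z ≠ 0 := by
    have h1 : ∀ᶠ q in nhds (z0, z0), P.evalEval q.1 q.2 ≠ 0 :=
      hPc.continuousAt.eventually_ne (by rw [hPd]; exact hz0)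
    obtain ⟨t, ht, ht'⟩ := Metric.eventually_nhds_iff_ball.1 h1
    refine ⟨t / 2, by positivity, fun u hu z hz => ht' (u, z) ?_⟩
    rw [← ball_prod_same]
    rw [Metric.mem_closedBall] at hu hz
    exact ⟨by rw [Metric.mem_ball]; linarith, by rw [Metric.mem_ball]; linarith⟩
  set B := Metric.ball z0 s with hB
  have hBc : B ⊆ Metric.closedBall z0 s := Metric.ball_subset_closedBall
  have hz0B : z0 ∈ B := Metric.mem_ball_self hs
  obtain ⟨Cb, hCb⟩ : ∃ Cb, ∀ u ∈ B, ∀ z ∈ B, ‖E.evalEval u z / P.evalEval u z‖ ≤ Cb := by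
    have hcomp : IsCompact (Metric.closedBall z0 s ×ˢ Metric.closedBall z0 s) :=
      (isCompact_closedBall _ _).prod (isCompact_closedBall _ _)
    obtain ⟨Cb, hCb⟩ := hcomp.exists_bound_of_continuousOn
      (f := fun q : ℂ × ℂ => E.evalEval q.1 q.2 / P.evalEval q.1 q.2)
      (hEc.continuousOn.div hPc.continuousOn (fun q hq => hPs q.1 hq.1 q.2 hq.2))
    exact ⟨Cb, fun u hu z hz => hCb (u, z) ⟨hBc hu, hBc hz⟩⟩
  have hinj : Set.InjOn (pf p) B := by
    intro x hx y hy hxy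
    have := hP x y
    rw [hxy, sub_self, eq_comm, mul_eq_zero] at this
    rcases this with h | h
    · exact (sub_eq_zero.1 h).symm
    · exact absurd h (hPs x (hBc hx) y (hBc hy))
  have hder : ∀ u ∈ B, deriv (pf p) u ≠ 0 := by
    intro u hu; rw [← hPd]; exact hPs u (hBc hu) u (hBc hu)
  set W := pf p '' B with hW
  have hWo : IsOpen W := pf_open p hdeg _ Metric.isOpen_ball
  have hBm : MeasurableSet B := Metric.isOpen_ball.measurableSet
  -- the change of variables
  have hcv : ∀ z, CT (W.indicator μ) (pf p z) =
      ∫ u in B, deriv (pf p) u ^ 2 * μ u * (pf p u - pf p z)⁻¹ := by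
    intro z
    have e1 : CT (W.indicator μ) (pf p z) = ∫ w in W, μ w * (w - pf p z)⁻¹ := by
      rw [CT, ← integral_indicator hWo.measurableSet]
      congr 1; ext w
      by_cases hw : w ∈ W <;> simp [hw]
    rw [e1, hW, integral_image_eq_integral_abs_det_fderiv_smul volume hBm
      (fun u _ => hasFDeriv_pf p B u) hinj]
    refine setIntegral_congr_fun hBm fun u hu => ?_
    simp only [det_real, abs_of_nonneg (normSq_nonneg _), real_smul]
    rw [← Complex.mul_conj]
    have := inv u (hder u hu)
    linear_combination (deriv (pf p) u * (pf p u - pf p z)⁻¹) * this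
  have hcvi : ∀ z, IntegrableOn (fun u => deriv (pf p) u ^ 2 * μ u * (pf p u - pf p z)⁻¹) B := by
    intro z
    have h1 : IntegrableOn (fun w => μ w * (w - pf p z)⁻¹) W := (hμ.integrable _).integrableOn
    rw [hW, integrableOn_image_iff_integrableOn_abs_det_fderiv_smul volume hBm
      (fun u _ => hasFDeriv_pf p B u) hinj] at h1
    refine h1.congr_fun (fun u hu => ?_) hBm
    simp only [det_real, abs_of_nonneg (normSq_nonneg _), real_smul]
    rw [← Complex.mul_conj]
    have := inv u (hder u hu)
    linear_combination (deriv (pf p) u * (pf p u - pf p z)⁻¹) * this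
  have hcv2 : ∀ z, CT (B.indicator μ) z = ∫ u in B, μ u * (u - z)⁻¹ := by
    intro z
    rw [CT, ← integral_indicator hBm]
    congr 1; ext w
    by_cases hw : w ∈ B <;> simp [hw]
  have hmain : ∀ z ∈ B, CT μ (pf p z) - deriv (pf p) z * CT μ z =
      (∫ u in B, μ u * (E.evalEval u z / P.evalEval u z)) +
      CT (Wᶜ.indicator μ) (pf p z) - deriv (pf p) z * CT (Bᶜ.indicator μ) z := by
    intro z hz
    rw [hμ.CT_split hWo.measurableSet (pf p z), hμ.CT_split hBm z, hcv, hcv2]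
    have : (∫ u in B, μ u * (E.evalEval u z / P.evalEval u z)) =
        (∫ u in B, deriv (pf p) u ^ 2 * μ u * (pf p u - pf p z)⁻¹) -
          deriv (pf p) z * ∫ u in B, μ u * (u - z)⁻¹ := by
      rw [← integral_const_mul, ← integral_sub (hcvi z) ((hμ.integrable z).integrableOn.const_mul _)]
      have hne : ∀ᵐ u : ℂ, u ≠ z := by
        rw [ae_iff]; simp
      refine setIntegral_congr_ae hBm ?_
      filter_upwards [hne] with u hu huB
      have h1 : u - z ≠ 0 := sub_ne_zero.2 hu
      have h2 := hPs u (hBc huB) z (hBc hz)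
      have h3 : pf p u - pf p z = (u - z) * P.evalEval u z := by
        linear_combination - hP u z
      rw [h3]
      field_simp
      linear_combination - μ u * hE u z
    rw [this]
    ring
  have hderd : Differentiable ℂ (deriv (pf p)) := by
    have : deriv (pf p) = fun z => p.derivative.eval z := by ext z; exact deriv_pf p z
    rw [this]; exact Polynomial.differentiable _
  have hd : DifferentiableAt ℂ (fun z => (∫ u in B, μ u * (E.evalEval u z / P.evalEval u z)) +
      CT (Wᶜ.indicator μ) (pf p z) - deriv (pf p) z * CT (Bᶜ.indicator μ) z) z0 := by
    refine DifferentiableAt.sub (DifferentiableAt.add ?_ ?_) (DifferentiableAt.mul (hderd _) ?_)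
    · refine hol_param (ν := volume.restrict B) (fun z u => μ u * (E.evalEval u z / P.evalEval u z))
        z0 hs (fun u => ‖μ u‖ * Cb) (hμ.integrable0.norm.mul_const _).integrableOn ?_ ?_ ?_
      · intro z hz
        refine Measurable.aestronglyMeasurable ?_
        refine hμ.meas.mul (Measurable.div ?_ ?_)
        · exact (hEc.comp (Continuous.prodMk_left z)).measurable
        · exact (hPc.comp (Continuous.prodMk_left z)).measurable
      · filter_upwards [ae_restrict_mem hBm] with u hu
        refine DifferentiableOn.const_mul (DifferentiableOn.div (biv_diff E u).differentiableOn
          (biv_diff P u).differentiableOn ?_) _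
        intro z hz
        exact hPs u (hBc hu) z (hBc hz)
      · filter_upwards [ae_restrict_mem hBm] with u hu z hz
        rw [norm_mul]
        exact mul_le_mul_of_nonneg_left (hCb u hu z hz) (norm_nonneg _)
    · refine DifferentiableAt.comp (g := CT (Wᶜ.indicator μ)) z0 ?_ (pf_diff p z0)
      refine (hμ.indicator hWo.measurableSet.compl).CT_diff ?_
      filter_upwards [hWo.mem_nhds ⟨z0, hz0B, rfl⟩] with w hw
      simp [hw]
    · refine (hμ.indicator hBm.compl).CT_diff ?_
      filter_upwards [Metric.isOpen_ball.mem_nhds hz0B] with w hw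
      simp [show w ∈ B from hw]
  refine hd.congr_of_eventuallyEq ?_
  filter_upwards [Metric.isOpen_ball.mem_nhds hz0B] with z hz
  exact hmain z hz

end NWD

namespace NWD
open Complex MeasureTheory Polynomial

lemma zero_of_zeros (m : ℕ) : ∀ (g : ℂ → ℂ) (S : Finset ℂ), Differentiable ℂ g → S.card = m →
    (∀ x ∈ S, g x = 0) →
    Filter.Tendsto (fun z => g z / z ^ m) (Filter.cocompact ℂ) (nhds 0) → ∀ z, g z = 0 := by
  induction m with
  | zero =>
    intro g S hg _ _ ht z
    simp only [pow_zero, div_one] at ht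
    exact hg.apply_eq_of_tendsto_cocompact z ht
  | succ m ih =>
    intro g S hg hS h0 ht
    obtain ⟨a, S', ha, rfl, hS'⟩ := Finset.card_eq_succ.1 hS
    have hga : g a = 0 := h0 a (Finset.mem_insert_self _ _)
    have hd : Differentiable ℂ (dslope g a) := by
      rw [← differentiableOn_univ]
      exact (Complex.differentiableOn_dslope Filter.univ_mem).2 hg.differentiableOn
    have hmul : ∀ z, g z = (z - a) * dslope g a z := by
      intro z
      have := sub_smul_dslope g a z
      rw [hga, sub_zero, smul_eq_mul] at this
      exact this.symm
    have := ih (dslope g a) S' hd hS' ?_ ?_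
    · intro z; rw [hmul, this, mul_zero]
    · intro x hx
      have h1 := h0 x (Finset.mem_insert_of_mem hx)
      rw [hmul, mul_eq_zero] at h1
      rcases h1 with h | h
      · rw [sub_eq_zero] at h; subst h; exact absurd hx ha
      · exact h
    · have h1 : Filter.Tendsto (fun z : ℂ => a * z⁻¹) (Filter.cocompact ℂ) (nhds 0) := by
        have := (Filter.tendsto_inv₀_cobounded (α := ℂ)).const_mul a
        rw [Metric.cobounded_eq_cocompact, mul_zero] at this
        exact this
      have h2 : Filter.Tendsto (fun z : ℂ => (1 - a * z⁻¹)⁻¹) (Filter.cocompact ℂ) (nhds 1) := by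
        have := ((tendsto_const_nhds (x := (1:ℂ))).sub h1).inv₀ (by simp)
        simpa using this
      have h3 := ht.mul h2
      rw [zero_mul] at h3
      refine h3.congr' ?_
      have hev : ∀ᶠ z : ℂ in Filter.cocompact ℂ, z ∉ ({0, a} : Set ℂ) := by
        have : ({0, a} : Set ℂ)ᶜ ∈ Filter.cocompact ℂ :=
          (Set.toFinite ({0, a} : Set ℂ)).isCompact.compl_mem_cocompact
        exact this
      filter_upwards [hev] with z hz
      simp only [Set.mem_insert_iff, Set.mem_singleton_iff, not_or] at hz
      have hz1 : z ≠ 0 := hz.1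
      have hz2 : z - a ≠ 0 := sub_ne_zero.2 hz.2
      have e : (1 - a * z⁻¹)⁻¹ = z / (z - a) := by
        rw [inv_eq_one_div, div_eq_div_iff]
        · field_simp
        · intro h0; apply hz2; field_simp at h0; simpa using h0
        · exact hz2
      rw [e, hmul z]
      field_simp
      ring

lemma poly_growth (q : ℂ[X]) (n : ℕ) (hq : q.natDegree ≤ n) :
    ∃ A : ℝ, 0 ≤ A ∧ ∀ z : ℂ, 1 ≤ ‖z‖ → ‖q.eval z‖ ≤ A * ‖z‖ ^ n := by
  refine ⟨∑ i ∈ Finset.range (n + 1), ‖q.coeff i‖, Finset.sum_nonneg fun _ _ => norm_nonneg _, ?_⟩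
  intro z hz
  rw [q.eval_eq_sum_range' (Nat.lt_succ_of_le hq), Finset.sum_mul]
  refine (norm_sum_le _ _).trans (Finset.sum_le_sum fun i hi => ?_)
  rw [norm_mul, norm_pow]
  refine mul_le_mul_of_nonneg_left ?_ (norm_nonneg _)
  exact pow_le_pow_right₀ hz (Nat.lt_succ_iff.1 (Finset.mem_range.1 hi))

lemma h_entire (p : ℂ[X]) (hdeg : 2 ≤ p.natDegree) {μ : ℂ → ℂ} {M R : ℝ} (hμ : Good μ M R)
    (inv : ∀ u, deriv (pf p) u ≠ 0 →
      μ (pf p u) * (starRingEnd ℂ) (deriv (pf p) u) = deriv (pf p) u * μ u) :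
    Differentiable ℂ (fun z => CT μ (pf p z) - deriv (pf p) z * CT μ z) := by
  intro z0
  by_cases hz0 : deriv (pf p) z0 ≠ 0
  · exact h_diff p hdeg hμ inv hz0
  · refine (Complex.analyticAt_of_differentiable_on_punctured_nhds_of_continuousAt ?_ ?_).differentiableAt
    · have hfin : ({k | p.derivative.eval k = 0} \ {z0}).Finite := (crit_finite p hdeg).sdiff
      have h1 : ({k | p.derivative.eval k = 0} \ {z0})ᶜ ∈ nhds z0 :=
        hfin.isClosed.isOpen_compl.mem_nhds (by simp)
      filter_upwards [mem_nhdsWithin_of_mem_nhds h1, self_mem_nhdsWithin] with z hz hz'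
      refine h_diff p hdeg hμ inv ?_
      rw [deriv_pf]
      intro h0
      exact hz ⟨h0, hz'⟩
    · have hdc : Continuous (deriv (pf p)) := by
        have : deriv (pf p) = fun z => p.derivative.eval z := by ext z; exact deriv_pf p z
        rw [this]; exact Polynomial.continuous _
      exact ((hμ.CT_cont.comp (pf_diff p).continuous).sub (hdc.mul hμ.CT_cont)).continuousAt

lemma h_growth (p : ℂ[X]) (hdeg : 2 ≤ p.natDegree) {μ : ℂ → ℂ} {M R : ℝ} (hμ : Good μ M R) :
    Filter.Tendsto (fun z => (CT μ (pf p z) - deriv (pf p) z * CT μ z) / z ^ (p.natDegree - 1))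
      (Filter.cocompact ℂ) (nhds 0) := by
  obtain ⟨Cb, hC0, hC⟩ := hμ.CT_bdd
  obtain ⟨A, hA0, hA⟩ := poly_growth p.derivative (p.natDegree - 1) p.natDegree_derivative_le
  have h1 : Filter.Tendsto (fun z : ℂ => Cb * ‖z‖⁻¹ + A * ‖CT μ z‖) (Filter.cocompact ℂ) (nhds 0) := by
    have e : (0:ℝ) = Cb * 0 + A * 0 := by ring
    rw [e]
    refine Filter.Tendsto.add (Filter.Tendsto.const_mul _ ?_) (Filter.Tendsto.const_mul _ ?_)
    · exact tendsto_inv_atTop_zero.comp (tendsto_norm_cocompact_atTop (E := ℂ))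
    · simpa using hμ.CT_tendsto.norm
  refine squeeze_zero_norm' ?_ h1
  filter_upwards [(tendsto_norm_cocompact_atTop (E := ℂ)).eventually (Filter.eventually_ge_atTop 1)] with z hz
  have hpos : 0 < ‖z‖ := by linarith
  rw [norm_div, norm_pow, div_le_iff₀ (by positivity)]
  refine (norm_sub_le _ _).trans ?_
  rw [add_mul, norm_mul, deriv_pf]
  refine add_le_add ?_ ?_
  · refine (hC _).trans ?_
    rw [mul_assoc]
    refine le_mul_of_one_le_right hC0 ?_
    obtain ⟨k, hk⟩ : ∃ k, p.natDegree - 1 = k + 1 := ⟨p.natDegree - 2, by omega⟩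
    rw [hk, pow_succ']
    rw [← mul_assoc, inv_mul_cancel₀ hpos.ne', one_mul]
    exact one_le_pow₀ hz
  · calc _ ≤ (A * ‖z‖ ^ (p.natDegree - 1)) * ‖CT μ z‖ :=
        mul_le_mul_of_nonneg_right (hA z hz) (norm_nonneg _)
      _ = _ := by ring

lemma h_zero (p : ℂ[X]) (hdeg : 2 ≤ p.natDegree) {μ : ℂ → ℂ} {M R : ℝ} (hμ : Good μ M R)
    (inv : ∀ u, deriv (pf p) u ≠ 0 →
      μ (pf p u) * (starRingEnd ℂ) (deriv (pf p) u) = deriv (pf p) u * μ u)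
    (hz : ∀ j : Fin (p.natDegree - 1), CT μ (pf p (j : ℕ)) - deriv (pf p) (j : ℕ) * CT μ (j : ℕ) = 0)
    (z : ℂ) : CT μ (pf p z) = deriv (pf p) z * CT μ z := by
  have := zero_of_zeros (p.natDegree - 1) _
    ((Finset.range (p.natDegree - 1)).image (fun j : ℕ => (j : ℂ))) (h_entire p hdeg hμ inv) ?_ ?_
    (h_growth p hdeg hμ) z
  · exact sub_eq_zero.1 this
  · rw [Finset.card_image_of_injective _ Nat.cast_injective, Finset.card_range]
  · intro x hx
    obtain ⟨j, hj, rfl⟩ := Finset.mem_image.1 hx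
    exact hz ⟨j, Finset.mem_range.1 hj⟩

end NWD

namespace NWD
open Complex MeasureTheory Polynomial

/-- the direction of a complex number -/
noncomputable def tau (x : ℂ) : ℂ := (starRingEnd ℂ) x / x

lemma tau_meas : Measurable tau := by
  unfold tau
  exact (Complex.continuous_conj.measurable).div measurable_id

lemma tau_mul (x y : ℂ) : tau (x * y) = tau x * tau y := by
  unfold tau; rw [map_mul, mul_div_mul_comm]

lemma tau_ne {x : ℂ} (hx : x ≠ 0) : tau x ≠ 0 := by
  unfold tau
  exact div_ne_zero (by simpa using hx) hx

lemma tau_norm {x : ℂ} (hx : x ≠ 0) : ‖tau x‖ = 1 := by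
  unfold tau
  rw [norm_div, RCLike.norm_conj, div_self (norm_ne_zero_iff.2 hx)]

lemma tau_norm_le (x : ℂ) : ‖tau x‖ ≤ 1 := by
  by_cases hx : x = 0
  · subst hx; simp [tau]
  · exact (tau_norm hx).le

lemma exists_mu (p : ℂ[X]) {Ω D : Set ℂ} (hDΩ : D ⊆ Ω) (hD : IsOpen D)
    (hinj : ∀ n, Set.InjOn ((pf p)^[n]) Ω) (hder : ∀ n, ∀ w ∈ Ω, deriv ((pf p)^[n]) w ≠ 0)
    (hdis : ∀ n m, n ≠ m → ∀ u ∈ Ω, ∀ v ∈ Ω, (pf p)^[n] u ≠ (pf p)^[m] v)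
    (g : ℂ → ℂ) (hg : Measurable g) :
    ∃ μ : ℂ → ℂ, Measurable μ ∧
      (∀ m n z, ∀ ζ ∈ D, (pf p)^[m] z = (pf p)^[n] ζ →
        μ z = g ζ / tau (deriv ((pf p)^[n]) ζ) * tau (deriv ((pf p)^[m]) z)) ∧
      (∀ z, (∀ m n, ∀ ζ ∈ D, (pf p)^[m] z ≠ (pf p)^[n] ζ) → μ z = 0) := by
  have hcont : ∀ n, Continuous ((pf p)^[n]) := fun n => (pf_iter_diff p n).continuous
  have hemb : ∀ n, MeasurableEmbedding (D.domRestrict ((pf p)^[n])) := fun n =>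
    (hcont n).continuousOn.measurableEmbedding hD.measurableSet ((hinj n).mono hDΩ)
  have hψ : ∀ n, ∃ ψ : ℂ → ℂ, Measurable ψ ∧ ∀ ζ ∈ D, ψ ((pf p)^[n] ζ) =
      g ζ / tau (deriv ((pf p)^[n]) ζ) := by
    intro n
    have hm : Measurable (fun ζ : D => g ζ / tau (deriv ((pf p)^[n]) ζ)) :=
      (hg.div (tau_meas.comp (measurable_deriv _))).comp measurable_subtype_coe
    obtain ⟨ψ, h1, h2⟩ := (hemb n).exists_measurable_extend hm (fun _ => ⟨0⟩)
    exact ⟨ψ, h1, fun ζ hζ => congrFun h2 ⟨ζ, hζ⟩⟩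
  choose ψ hψm hψv using hψ
  have hEm : ∀ m n, MeasurableSet ((pf p)^[m] ⁻¹' ((pf p)^[n] '' D)) := by
    intro m n
    refine (hcont m).measurable ?_
    have := (hemb n).measurableSet_range
    rwa [Set.range_domRestrict] at this
  let t : Option (ℕ × ℕ) → Set ℂ := fun i => match i with
    | none => (⋃ q : ℕ × ℕ, (pf p)^[q.1] ⁻¹' ((pf p)^[q.2] '' D))ᶜ
    | some q => (pf p)^[q.1] ⁻¹' ((pf p)^[q.2] '' D)
  let G : Option (ℕ × ℕ) → ℂ → ℂ := fun i => match i with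
    | none => fun _ => 0
    | some q => fun z => ψ q.2 ((pf p)^[q.1] z) * tau (deriv ((pf p)^[q.1]) z)
  -- consistency
  have hcons : ∀ m n m' n' z, ∀ ζ ∈ D, ∀ ζ' ∈ D, m ≤ m' → (pf p)^[m] z = (pf p)^[n] ζ →
      (pf p)^[m'] z = (pf p)^[n'] ζ' →
      g ζ / tau (deriv ((pf p)^[n]) ζ) * tau (deriv ((pf p)^[m]) z) =
      g ζ' / tau (deriv ((pf p)^[n']) ζ') * tau (deriv ((pf p)^[m']) z) := by
    intro m n m' n' z ζ hζ ζ' hζ' hmm h1 h2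
    obtain ⟨j, rfl⟩ := Nat.exists_eq_add_of_le' hmm
    rw [Function.iterate_add_apply, h1, ← Function.iterate_add_apply] at h2
    have hn : j + n = n' := by
      by_contra hne
      exact hdis _ _ hne ζ (hDΩ hζ) ζ' (hDΩ hζ') h2
    subst hn
    have hζζ : ζ = ζ' := hinj _ (hDΩ hζ) (hDΩ hζ') h2
    subst hζζ
    have hne := hder (j + n) ζ (hDΩ hζ)
    rw [deriv_iter_add] at hne
    have ha := tau_ne (left_ne_zero_of_mul hne)
    have hb := tau_ne (right_ne_zero_of_mul hne)
    rw [deriv_iter_add, deriv_iter_add, h1, tau_mul, tau_mul]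
    field_simp
  have htm : ∀ i, MeasurableSet (t i) := fun i => by
    cases i with
    | none => exact (MeasurableSet.iUnion fun q : ℕ × ℕ => hEm q.1 q.2).compl
    | some q => exact hEm q.1 q.2
  have hGm : ∀ i, Measurable (G i) := fun i => by
    cases i with
    | none => exact measurable_const
    | some q =>
      exact ((hψm q.2).comp (hcont q.1).measurable).mul (tau_meas.comp (measurable_deriv _))
  obtain ⟨μ, hμm, hμ⟩ := exists_measurable_piecewise t htm G hGm
    (by
      intro i j hij z hz
      cases i with
      | none =>
        cases j with
        | none => rfl
        | some q => exact absurd (Set.mem_iUnion.2 ⟨q, hz.2⟩) hz.1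
      | some q =>
        cases j with
        | none => exact absurd (Set.mem_iUnion.2 ⟨q, hz.1⟩) hz.2
        | some q' =>
          obtain ⟨⟨ζ, hζ, e1⟩, ⟨ζ', hζ', e2⟩⟩ := hz
          show ψ q.2 ((pf p)^[q.1] z) * tau (deriv ((pf p)^[q.1]) z) =
            ψ q'.2 ((pf p)^[q'.1] z) * tau (deriv ((pf p)^[q'.1]) z)
          rw [← e1, ← e2, hψv _ ζ hζ, hψv _ ζ' hζ']
          rcases le_total q.1 q'.1 with h | h
          · exact hcons _ _ _ _ z ζ hζ ζ' hζ' h e1.symm e2.symm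
          · exact (hcons _ _ _ _ z ζ' hζ' ζ hζ h e2.symm e1.symm).symm)
  refine ⟨μ, hμm, ?_, ?_⟩
  · intro m n z ζ hζ h
    have h1 := hμ (some (m, n)) (show z ∈ t (some (m, n)) from ⟨ζ, hζ, h.symm⟩)
    rw [h1]
    show ψ n ((pf p)^[m] z) * _ = _
    rw [h, hψv n ζ hζ]
  · intro z hz
    refine hμ none (show z ∈ t none from ?_)
    intro h
    obtain ⟨q, ζ, hζ, e⟩ := Set.mem_iUnion.1 h
    exact hz q.1 q.2 ζ hζ e.symm

lemma Kf_iter (p : ℂ[X]) (n : ℕ) (z : ℂ) : (pf p)^[n] z ∈ Kf p ↔ z ∈ Kf p := by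
  induction n with
  | zero => rfl
  | succ n ih => rw [Function.iterate_succ_apply', Kf_step, ih]

/-- invariant Beltrami differentials -/
lemma exists_inv_mu (p : ℂ[X]) {Ω D : Set ℂ} (hDΩ : D ⊆ Ω) (hD : IsOpen D) (hΩK : Ω ⊆ Kf p)
    (hinj : ∀ n, Set.InjOn ((pf p)^[n]) Ω) (hder : ∀ n, ∀ w ∈ Ω, deriv ((pf p)^[n]) w ≠ 0)
    (hdis : ∀ n m, n ≠ m → ∀ u ∈ Ω, ∀ v ∈ Ω, (pf p)^[n] u ≠ (pf p)^[m] v)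
    {R : ℝ} (hR : ∀ z ∈ Kf p, ‖z‖ ≤ R)
    (g : ℂ → ℂ) (hg : Measurable g) {M : ℝ} (hM0 : 0 ≤ M) (hM : ∀ ζ ∈ D, ‖g ζ‖ ≤ M) :
    ∃ μ : ℂ → ℂ, Good μ M R ∧
      (∀ u, deriv (pf p) u ≠ 0 →
        μ (pf p u) * (starRingEnd ℂ) (deriv (pf p) u) = deriv (pf p) u * μ u) ∧
      (∀ ζ ∈ D, μ ζ = g ζ) ∧ (∀ ζ ∈ Ω, ζ ∉ D → μ ζ = 0) := by
  obtain ⟨μ, hμm, h1, h2⟩ := exists_mu p hDΩ hD hinj hder hdis g hg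
  refine ⟨μ, ⟨hμm, ?_, ?_⟩, ?_, ?_, ?_⟩
  · intro z
    by_cases h : ∀ m n, ∀ ζ ∈ D, (pf p)^[m] z ≠ (pf p)^[n] ζ
    · rw [h2 z h, norm_zero]; exact hM0
    · push Not at h
      obtain ⟨m, n, ζ, hζ, e⟩ := h
      rw [h1 m n z ζ hζ e, norm_mul, norm_div, tau_norm (hder n ζ (hDΩ hζ)), div_one]
      calc _ ≤ M * 1 := mul_le_mul (hM ζ hζ) (tau_norm_le _) (norm_nonneg _) hM0
        _ = M := mul_one M
  · intro w hw
    refine h2 w fun m n ζ hζ e => ?_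
    have : (pf p)^[m] w ∈ Kf p := by rw [e, Kf_iter]; exact hΩK (hDΩ hζ)
    rw [Kf_iter] at this
    exact absurd (hR w this) (not_le.2 hw)
  · intro u hu
    have key : μ u = μ (pf p u) * tau (deriv (pf p) u) := by
      by_cases h : ∀ m n, ∀ ζ ∈ D, (pf p)^[m] (pf p u) ≠ (pf p)^[n] ζ
      · rw [h2 _ h, zero_mul]
        refine h2 _ fun m n ζ hζ e => ?_
        refine h m (n + 1) ζ hζ ?_
        rw [← Function.iterate_succ_apply, Function.iterate_succ_apply', e, Function.iterate_succ_apply']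
      · push Not at h
        obtain ⟨m, n, ζ, hζ, e⟩ := h
        rw [h1 m n _ ζ hζ e]
        have e' : (pf p)^[m + 1] u = (pf p)^[n] ζ := e
        rw [h1 (m + 1) n _ ζ hζ e']
        have := deriv_iter_add p m 1 u
        rw [Function.iterate_one] at this
        rw [this, tau_mul, mul_assoc]
    rw [key, tau]
    field_simp
  · intro ζ hζ
    have := h1 0 0 ζ ζ hζ rfl
    rw [this]
    simp [tau]
  · intro z hz hzD
    refine h2 z fun m n ζ hζ e => ?_
    by_cases hmn : m = n
    · subst hmn
      have := hinj m hz (hDΩ hζ) e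
      rw [this] at hzD
      exact hzD hζ
    · exact hdis m n hmn z hz ζ (hDΩ hζ) e

end NWD

namespace NWD
open Complex MeasureTheory Polynomial

lemma CT_iter (p : ℂ[X]) {v : ℂ → ℂ} (hv : ∀ z, v (pf p z) = deriv (pf p) z * v z) (n : ℕ) (z : ℂ) :
    v ((pf p)^[n] z) = deriv ((pf p)^[n]) z * v z := by
  induction n with
  | zero => simp
  | succ n ih => rw [Function.iterate_succ_apply', hv, ih, deriv_iter_succ, mul_assoc]

lemma v_zero_julia (p : ℂ[X]) {v : ℂ → ℂ} (hc : Continuous v)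
    {Cb : ℝ} (hb : ∀ z, ‖v z‖ ≤ Cb) (hv : ∀ z, v (pf p z) = deriv (pf p) z * v z)
    {z : ℂ} (hz : z ∈ Kf p) (hzi : z ∉ interior (Kf p)) : v z = 0 := by
  by_contra h0
  apply hzi
  have hpos : 0 < ‖v z‖ := norm_pos_iff.2 h0
  have hev : ∀ᶠ w in nhds z, ‖v z‖ / 2 < ‖v w‖ :=
    hc.norm.continuousAt.eventually (lt_mem_nhds (by linarith))
  obtain ⟨s, hs, hs'⟩ := Metric.eventually_nhds_iff_ball.1 hev
  rw [mem_interior]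
  refine ⟨Metric.ball z s, ?_, Metric.isOpen_ball, Metric.mem_ball_self hs⟩
  intro w hw
  have hder : ∀ n, ∀ x ∈ Metric.ball z s, ‖deriv ((pf p)^[n]) x‖ ≤ Cb / (‖v z‖ / 2) := by
    intro n x hx
    have h1 := congrArg norm (CT_iter p hv n x)
    rw [norm_mul] at h1
    have h2 := hs' x hx
    rw [le_div_iff₀ (by positivity)]
    calc _ ≤ ‖deriv ((pf p)^[n]) x‖ * ‖v x‖ := mul_le_mul_of_nonneg_left h2.le (norm_nonneg _)
      _ ≤ Cb := by rw [← h1]; exact hb _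
  have hbd : ∀ n, ‖(pf p)^[n] w - (pf p)^[n] z‖ ≤ Cb / (‖v z‖ / 2) * ‖w - z‖ := fun n =>
    (convex_ball z s).norm_image_sub_le_of_norm_deriv_le (fun x _ => pf_iter_diff p n x)
      (hder n) (Metric.mem_ball_self hs) hw
  have hz' : Bornology.IsBounded (Set.range fun n : ℕ => (pf p)^[n] z) := hz
  obtain ⟨A, hA⟩ := hz'.exists_norm_le
  show Bornology.IsBounded (Set.range fun n : ℕ => (pf p)^[n] w)
  refine (Metric.isBounded_closedBall (x := (0:ℂ)) (r := A + Cb / (‖v z‖ / 2) * ‖w - z‖)).subset ?_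
  rintro _ ⟨n, rfl⟩
  have h1 := hA _ ⟨n, rfl⟩
  have h2 := norm_sub_norm_le ((pf p)^[n] w) ((pf p)^[n] z)
  have h3 := hbd n
  simp only [mem_closedBall_zero_iff]
  linarith

lemma Kf_closed (p : ℂ[X]) (hdeg : 2 ≤ p.natDegree) : IsClosed (Kf p) := by
  obtain ⟨R, hR, hK⟩ := exists_Kf_radius p hdeg
  have : Kf p = ⋂ n : ℕ, {z | ‖(pf p)^[n] z‖ ≤ R} := by
    ext z; rw [hK]; simp
  rw [this]
  refine isClosed_iInter fun n => ?_
  exact isClosed_le (pf_iter_diff p n).continuous.norm continuous_const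

lemma frontier_Uc (p : ℂ[X]) (hdeg : 2 ≤ p.natDegree) {z x : ℂ} (hx : x ∈ frontier (Uc p z)) :
    x ∈ Kf p ∧ x ∉ interior (Kf p) := by
  have hop : ∀ y, IsOpen (Uc p y) := fun y => isOpen_interior.connectedComponentIn
  constructor
  · have h1 : Uc p z ⊆ Kf p := (connectedComponentIn_subset _ _).trans interior_subset
    exact closure_minimal h1 (Kf_closed p hdeg) (frontier_subset_closure hx)
  · intro hi
    have hxx : x ∈ Uc p x := mem_connectedComponentIn hi
    obtain ⟨y, hy1, hy2⟩ := mem_closure_iff_nhds.1 (frontier_subset_closure hx) _ ((hop x).mem_nhds hxx)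
    have := Uc_eq_of_mem p hy1 hy2
    rw [this] at hxx
    rw [(hop z).frontier_eq] at hx
    exact hx.2 hxx

/-- vanishing on an annular region -/
lemma v_zero_annulus {Ω : Set ℂ} (hΩb : Bornology.IsBounded Ω) {a : ℂ} {r : ℝ}
    (hr : 0 < r) {v : ℂ → ℂ} (hc : Continuous v)
    {Cb : ℝ} (hb : ∀ z, ‖v z‖ ≤ Cb) (hfr : ∀ x ∈ frontier Ω, v x = 0)
    (hd : ∀ z ∈ Ω, z ∉ Metric.closedBall a r → DifferentiableAt ℂ v z)
    {z : ℂ} (hz : z ∈ Ω) (hza : z ∉ Metric.closedBall a r) : v z = 0 := by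
  have hC0 : 0 ≤ Cb := (norm_nonneg _).trans (hb 0)
  set W := Ω ∩ (Metric.closedBall a r)ᶜ with hW
  have hWb : Bornology.IsBounded W := hΩb.subset Set.inter_subset_left
  have hk : ∀ k : ℕ, ‖v z‖ * ‖z - a‖ ^ k ≤ Cb * r ^ k := by
    intro k
    have := Complex.norm_le_of_forall_mem_frontier_norm_le (f := fun z => v z * (z - a) ^ k)
      (C := Cb * r ^ k) hWb ?_ ?_ (subset_closure (show z ∈ W from ⟨hz, hza⟩))
    · simpa using this
    · refine ⟨?_, ?_⟩
      · intro y hy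
        refine DifferentiableAt.differentiableWithinAt ?_
        exact (hd y hy.1 hy.2).mul (by fun_prop)
      · exact (hc.mul (by fun_prop)).continuousOn
    · intro y hy
      have h1 := frontier_inter_subset _ _ hy
      rcases h1 with ⟨h1, -⟩ | ⟨-, h1⟩
      · simp only [hfr y h1, zero_mul, norm_zero]; positivity
      · rw [frontier_compl, frontier_closedBall _ hr.ne', mem_sphere_iff_norm] at h1
        rw [norm_mul, norm_pow, h1]
        exact mul_le_mul_of_nonneg_right (hb y) (by positivity)
  have hlt : r < ‖z - a‖ := by
    rw [Metric.mem_closedBall, not_le, dist_eq_norm] at hza; exact hza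
  have hpos : 0 < ‖z - a‖ := hr.trans hlt
  have hk' : ∀ k : ℕ, ‖v z‖ ≤ Cb * (r / ‖z - a‖) ^ k := by
    intro k
    rw [div_pow, ← mul_div_assoc, le_div_iff₀ (by positivity)]
    exact hk k
  have ht : Filter.Tendsto (fun k : ℕ => Cb * (r / ‖z - a‖) ^ k) Filter.atTop (nhds 0) := by
    have := (tendsto_pow_atTop_nhds_zero_of_lt_one (r := r / ‖z - a‖) (by positivity)
      ((div_lt_one hpos).2 hlt)).const_mul Cb
    simpa using this
  exact norm_le_zero_iff.1 (ge_of_tendsto' ht hk')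

/-- the local part of the Cauchy transform vanishes outside the disc -/
lemma A_zero {μ : ℂ → ℂ} {M R : ℝ} (hμ : Good μ M R) {Ω : Set ℂ} (hΩ : IsOpen Ω)
    {a : ℂ} {r : ℝ} (hsub : Metric.closedBall a r ⊆ Ω)
    (h0 : ∀ ζ ∈ Ω, ζ ∉ Metric.ball a r → μ ζ = 0)
    (hv : ∀ z ∈ Ω, z ∉ Metric.closedBall a r → CT μ z = 0)
    {z : ℂ} (hz : z ∉ Metric.closedBall a r) : CT ((Metric.ball a r).indicator μ) z = 0 := by
  classical
  have hDm : MeasurableSet (Metric.ball a r) := Metric.isOpen_ball.measurableSet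
  set A := CT ((Metric.ball a r).indicator μ) with hA
  set B := CT ((Metric.ball a r)ᶜ.indicator μ) with hB
  have hAB : ∀ z, CT μ z = A z + B z := hμ.CT_split hDm
  have hAd : ∀ z, z ∉ Metric.closedBall a r → DifferentiableAt ℂ A z := by
    intro z hz
    refine (hμ.indicator hDm).CT_diff ?_
    filter_upwards [Metric.isClosed_closedBall.isOpen_compl.mem_nhds hz] with w hw
    exact Set.indicator_of_notMem (fun h => hw (Metric.ball_subset_closedBall h)) _
  have hBd : ∀ z ∈ Ω, DifferentiableAt ℂ B z := by
    intro z hz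
    refine (hμ.indicator hDm.compl).CT_diff ?_
    filter_upwards [hΩ.mem_nhds hz] with w hw
    by_cases hwD : w ∈ Metric.ball a r
    · exact Set.indicator_of_notMem (Set.notMem_compl_iff.2 hwD) _
    · rw [Set.indicator_of_mem (show w ∈ (Metric.ball a r)ᶜ from hwD), h0 w hw hwD]
  let G : ℂ → ℂ := fun z => if z ∈ Ω then - B z else A z
  have hGA : ∀ z, z ∉ Metric.closedBall a r → G z = A z := by
    intro z hz
    by_cases hzΩ : z ∈ Ω
    · simp only [G, if_pos hzΩ]
      have := hAB z
      rw [hv z hzΩ hz] at this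
      linear_combination this
    · simp only [G, if_neg hzΩ]
  have hGd : Differentiable ℂ G := by
    intro z
    by_cases hzΩ : z ∈ Ω
    · refine (hBd z hzΩ).neg.congr_of_eventuallyEq ?_
      filter_upwards [hΩ.mem_nhds hzΩ] with w hw
      simp [G, hw]
    · have hz' : z ∉ Metric.closedBall a r := fun h => hzΩ (hsub h)
      refine (hAd z hz').congr_of_eventuallyEq ?_
      filter_upwards [Metric.isClosed_closedBall.isOpen_compl.mem_nhds hz'] with w hw
      exact hGA w hw
  have hGt : Filter.Tendsto G (Filter.cocompact ℂ) (nhds 0) := by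
    refine (hμ.indicator hDm).CT_tendsto.congr' ?_
    filter_upwards [(isCompact_closedBall a r).compl_mem_cocompact] with w hw
    exact (hGA w hw).symm
  rw [← hGA z hz]
  exact hGd.apply_eq_of_tendsto_cocompact z hGt

lemma moments {ν : ℂ → ℂ} {M R : ℝ} (hν : Good ν M R) {a : ℂ} {r : ℝ}
    (h0 : ∀ z, z ∉ Metric.closedBall a r → CT ν z = 0) (j : ℕ) :
    (∃ M', Good (fun w => ν w * (w - a) ^ j) M' R) ∧
    (∀ z, z ∉ Metric.closedBall a r → CT (fun w => ν w * (w - a) ^ j) z = 0) := by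
  have hgood : ∀ j : ℕ, Good (fun w => ν w * (w - a) ^ j) (M * (|R| + ‖a‖) ^ j) R := by
    intro j
    have hM := hν.Mnn
    refine ⟨hν.meas.mul (by fun_prop), fun w => ?_, fun w hw => by rw [hν.supp w hw, zero_mul]⟩
    by_cases hw : R < ‖w‖
    · rw [hν.supp w hw, zero_mul, norm_zero]; positivity
    · push Not at hw
      rw [norm_mul, norm_pow]
      have h1 : ‖w - a‖ ≤ |R| + ‖a‖ := (norm_sub_le _ _).trans (by linarith [le_abs_self R])
      exact mul_le_mul (hν.bd w) (pow_le_pow_left₀ (norm_nonneg _) h1 _) (by positivity) hM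
  refine ⟨⟨_, hgood j⟩, ?_⟩
  induction j with
  | zero => simpa using h0
  | succ j ih =>
    have hstep : ∀ z, z ∉ Metric.closedBall a r → CT (fun w => ν w * (w - a) ^ (j + 1)) z =
        ∫ w, ν w * (w - a) ^ j := by
      intro z hz
      have h1 := ih z hz
      have e : CT (fun w => ν w * (w - a) ^ (j + 1)) z = (∫ w, ν w * (w - a) ^ j) +
          (z - a) * CT (fun w => ν w * (w - a) ^ j) z := by
        unfold CT
        rw [← integral_const_mul, ← integral_add (hgood j).integrable0
          (((hgood j).integrable z).const_mul _)]
        have hne : ∀ᵐ u : ℂ, u ≠ z := by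
          rw [ae_iff]; simp
        refine integral_congr_ae ?_
        filter_upwards [hne] with w hw
        have : w - z ≠ 0 := sub_ne_zero.2 hw
        field_simp
        ring
      rw [e, h1, mul_zero, add_zero]
    have hm : (∫ w, ν w * (w - a) ^ j) = 0 := by
      refine tendsto_nhds_unique (f := fun _ : ℂ => ∫ w, ν w * (w - a) ^ j) (l := Filter.cocompact ℂ)
        tendsto_const_nhds ?_
      refine (hgood (j + 1)).CT_tendsto.congr' ?_
      filter_upwards [(isCompact_closedBall a r).compl_mem_cocompact] with w hw
      exact hstep w hw
    intro z hz
    rw [hstep z hz, hm]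

lemma moments_zero {ν : ℂ → ℂ} {M R : ℝ} (hν : Good ν M R) {a : ℂ} {r : ℝ}
    (h0 : ∀ z, z ∉ Metric.closedBall a r → CT ν z = 0) (j : ℕ) :
    ∫ w, ν w * (w - a) ^ j = 0 := by
  obtain ⟨⟨M1, g1⟩, z1⟩ := moments hν h0 j
  obtain ⟨⟨M2, g2⟩, z2⟩ := moments hν h0 (j + 1)
  obtain ⟨z, hz⟩ : ∃ z, z ∉ Metric.closedBall a r := by
    by_contra h
    push Not at h
    have : Metric.closedBall a r = Set.univ := Set.eq_univ_of_forall h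
    have hb := Metric.isBounded_closedBall (x := a) (r := r)
    rw [this] at hb
    exact NormedSpace.unbounded_univ ℂ ℂ hb
  have e : CT (fun w => ν w * (w - a) ^ (j + 1)) z = (∫ w, ν w * (w - a) ^ j) +
      (z - a) * CT (fun w => ν w * (w - a) ^ j) z := by
    unfold CT
    rw [← integral_const_mul, ← integral_add g1.integrable0 ((g1.integrable z).const_mul _)]
    have hne : ∀ᵐ u : ℂ, u ≠ z := by
      rw [ae_iff]; simp
    refine integral_congr_ae ?_
    filter_upwards [hne] with w hw
    have : w - z ≠ 0 := sub_ne_zero.2 hw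
    field_simp
    ring
  rw [z1 z hz, z2 z hz] at e
  simpa using e.symm

end NWD

namespace NWD
open Complex MeasureTheory Polynomial

/-- orthogonality kills the coefficients -/
lemma coeffs_vanish {d : ℕ} (c : Fin d → ℂ) {a : ℂ} {r : ℝ} (hr : 0 < r) {ν : ℂ → ℂ} {M R : ℝ}
    (hν : Good ν M R)
    (h1 : ∀ w ∈ Metric.ball a r, ν w = ∑ k, c k * ((starRingEnd ℂ) (w - a)) ^ (k : ℕ))
    (h2 : ∀ w, w ∉ Metric.ball a r → ν w = 0)
    (hm : ∀ j : ℕ, Integrable (fun w => ν w * (w - a) ^ j) ∧ ∫ w, ν w * (w - a) ^ j = 0) : c = 0 := by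
  set Q : ℂ → ℂ := fun w => ∑ k, (starRingEnd ℂ) (c k) * (w - a) ^ (k : ℕ) with hQ
  have hνQ : ∀ w ∈ Metric.ball a r, ν w = (starRingEnd ℂ) (Q w) := by
    intro w hw
    rw [h1 w hw, hQ]; simp
  have hQc : Continuous Q := by
    refine continuous_finsetSum _ fun k _ => ?_
    fun_prop
  have hQint : ∫ w, ν w * Q w = 0 := by
    have e : (fun w => ν w * Q w) = fun w => ∑ k, (starRingEnd ℂ) (c k) * (ν w * (w - a) ^ (k : ℕ)) := by
      ext w
      rw [hQ, Finset.mul_sum]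
      refine Finset.sum_congr rfl fun k _ => by ring
    rw [e, integral_finsetSum _ (fun (k : Fin d) _ => (hm (k:ℕ)).1.const_mul _)]
    refine Finset.sum_eq_zero fun k _ => ?_
    rw [integral_const_mul, (hm k).2, mul_zero]
  have e2 : ∀ w, ν w * Q w = (((Metric.ball a r).indicator (fun w => normSq (Q w)) w : ℝ) : ℂ) := by
    intro w
    by_cases hw : w ∈ Metric.ball a r
    · rw [hνQ w hw, Set.indicator_of_mem hw, mul_comm, Complex.mul_conj]
    · rw [h2 w hw, Set.indicator_of_notMem hw]; simp
  simp_rw [e2] at hQint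
  rw [integral_complex_ofReal] at hQint
  have hQint' : ∫ w in Metric.ball a r, normSq (Q w) = 0 := by
    rw [← integral_indicator Metric.isOpen_ball.measurableSet]
    exact_mod_cast hQint
  have hcn : Continuous (fun w => normSq (Q w)) := Complex.continuous_normSq.comp hQc
  have hio : IntegrableOn (fun w => normSq (Q w)) (Metric.ball a r) :=
    (hcn.continuousOn.integrableOn_compact (isCompact_closedBall a r)).mono_set
      Metric.ball_subset_closedBall
  rw [setIntegral_eq_zero_iff_of_nonneg_ae (Filter.Eventually.of_forall fun w => normSq_nonneg _) hio] at hQint'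
  have hz := Measure.eqOn_open_of_ae_eq hQint' Metric.isOpen_ball hcn.continuousOn continuousOn_const
  let q : ℂ[X] := ∑ k : Fin d, C ((starRingEnd ℂ) (c k)) * X ^ (k : ℕ)
  have hq0 : q = 0 := by
    refine Polynomial.eq_zero_of_infinite_isRoot q ?_
    have hinf : (Metric.ball (0:ℂ) r).Infinite := infinite_of_mem_nhds 0 (Metric.ball_mem_nhds _ hr)
    refine hinf.mono fun x hx => ?_
    have hx' : x + a ∈ Metric.ball a r := by simpa using hx
    have h3 : normSq (Q (x + a)) = 0 := hz hx'
    rw [Complex.normSq_eq_zero] at h3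
    show q.eval x = 0
    rw [← h3, hQ]
    simp [q, Polynomial.eval_finsetSum]
  ext k
  have h4 : q.coeff k = (starRingEnd ℂ) (c k) := by
    simp only [q, Polynomial.finsetSum_coeff, Polynomial.coeff_C_mul, Polynomial.coeff_X_pow]
    rw [Finset.sum_eq_single k]
    · simp
    · intro b _ hb
      have : (k : ℕ) ≠ b := fun h => hb (Fin.ext h.symm)
      simp [this]
    · simp
  rw [hq0, Polynomial.coeff_zero] at h4
  simpa using h4.symm

lemma core (p : ℂ[X]) (hdeg : 2 ≤ p.natDegree) {z0 : ℂ} (hz0 : z0 ∈ interior (Kf p))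
    (hinj : ∀ n, Set.InjOn ((pf p)^[n]) (Uc p z0))
    (hder : ∀ n, ∀ w ∈ Uc p z0, deriv ((pf p)^[n]) w ≠ 0)
    (hdis : ∀ n m, n ≠ m → ∀ u ∈ Uc p z0, ∀ v ∈ Uc p z0, (pf p)^[n] u ≠ (pf p)^[m] v) : False := by
  set Ω := Uc p z0 with hΩdef
  have hΩ : IsOpen Ω := isOpen_interior.connectedComponentIn
  have hΩK : Ω ⊆ Kf p := (connectedComponentIn_subset _ _).trans interior_subset
  obtain ⟨R, hR, hK⟩ := exists_Kf_radius p hdeg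
  have hKR : ∀ z ∈ Kf p, ‖z‖ ≤ R := fun z hz => (hK z).1 hz 0
  have hΩb : Bornology.IsBounded Ω := by
    refine (Metric.isBounded_closedBall (x := (0:ℂ)) (r := R)).subset fun w hw => ?_
    simpa using hKR w (hΩK hw)
  have ha : z0 ∈ Ω := mem_connectedComponentIn hz0
  set a := z0 with hadef
  obtain ⟨r, hr, hrΩ⟩ := Metric.nhds_basis_closedBall.mem_iff.1 (hΩ.mem_nhds ha)
  have hDΩ : Metric.ball a r ⊆ Ω := Metric.ball_subset_closedBall.trans hrΩ
  -- the invariant differentials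
  have hex : ∀ k : ℕ, ∃ μ : ℂ → ℂ, Good μ (r ^ k) R ∧
      (∀ u, deriv (pf p) u ≠ 0 →
        μ (pf p u) * (starRingEnd ℂ) (deriv (pf p) u) = deriv (pf p) u * μ u) ∧
      (∀ ζ ∈ Metric.ball a r, μ ζ = ((starRingEnd ℂ) (ζ - a)) ^ k) ∧
      (∀ ζ ∈ Ω, ζ ∉ Metric.ball a r → μ ζ = 0) := by
    intro k
    refine exists_inv_mu p hDΩ Metric.isOpen_ball hΩK hinj hder hdis hKR
      (fun ζ => ((starRingEnd ℂ) (ζ - a)) ^ k) ?_ (by positivity) ?_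
    · refine Continuous.measurable ?_
      exact (Complex.continuous_conj.comp (continuous_id.sub continuous_const)).pow k
    · intro ζ hζ
      rw [norm_pow, RCLike.norm_conj]
      rw [mem_ball_iff_norm] at hζ
      exact pow_le_pow_left₀ (norm_nonneg _) hζ.le k
  choose μs hg hinv hon hoff using hex
  -- linear algebra
  set d := p.natDegree with hd
  let H : ℕ → ℂ → ℂ := fun k z => CT (μs k) (pf p z) - deriv (pf p) z * CT (μs k) z
  let A : Matrix (Fin (d - 1)) (Fin d) ℂ := fun j k => H k ((j : ℕ) : ℂ)
  have hker : LinearMap.ker A.mulVecLin ≠ ⊥ := by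
    refine LinearMap.ker_ne_bot_of_finrank_lt ?_
    simp only [Module.finrank_fintype_fun_eq_card, Fintype.card_fin]
    omega
  obtain ⟨c, hcker, hc0⟩ := (Submodule.ne_bot_iff _).1 hker
  apply hc0
  have hcA : ∀ j : Fin (d - 1), ∑ k : Fin d, H k ((j : ℕ) : ℂ) * c k = 0 := by
    intro j
    have := congrFun (LinearMap.mem_ker.1 hcker) j
    exact this
  set μ : ℂ → ℂ := fun w => ∑ k : Fin d, c k * μs k w with hμdef
  have hμ : Good μ (∑ k : Fin d, ‖c k‖ * r ^ (k : ℕ)) R := by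
    refine ⟨?_, ?_, ?_⟩
    · exact Finset.measurable_sum _ fun k _ => (hg k).meas.const_mul _
    · intro w
      refine (norm_sum_le _ _).trans (Finset.sum_le_sum fun k _ => ?_)
      rw [norm_mul]
      exact mul_le_mul_of_nonneg_left ((hg k).bd w) (norm_nonneg _)
    · intro w hw
      refine Finset.sum_eq_zero fun k _ => ?_
      rw [(hg k).supp w hw, mul_zero]
  have hμinv : ∀ u, deriv (pf p) u ≠ 0 →
        μ (pf p u) * (starRingEnd ℂ) (deriv (pf p) u) = deriv (pf p) u * μ u := by
    intro u hu
    simp only [hμdef]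
    rw [Finset.sum_mul, Finset.mul_sum]
    refine Finset.sum_congr rfl fun k _ => ?_
    have := hinv k u hu
    linear_combination c k * this
  have hCT : ∀ z, CT μ z = ∑ k : Fin d, c k * CT (μs k) z := by
    intro z
    unfold CT
    simp_rw [← integral_const_mul]
    rw [← integral_finsetSum _ (fun (k : Fin d) _ => ((hg (k:ℕ)).integrable z).const_mul _)]
    congr 1; ext w
    simp only [hμdef, Finset.sum_mul]
    refine Finset.sum_congr rfl fun k _ => by ring
  have hv : ∀ z, CT μ (pf p z) = deriv (pf p) z * CT μ z := by
    refine h_zero p hdeg hμ hμinv fun j => ?_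
    rw [hCT, hCT, Finset.mul_sum, ← Finset.sum_sub_distrib, ← hcA j]
    refine Finset.sum_congr rfl fun k _ => by simp only [H]; ring
  obtain ⟨Cb, hCb0, hCb⟩ := hμ.CT_bdd
  have hoffμ : ∀ ζ ∈ Ω, ζ ∉ Metric.ball a r → μ ζ = 0 := by
    intro ζ h1 h2
    refine Finset.sum_eq_zero fun k _ => ?_
    rw [hoff k ζ h1 h2, mul_zero]
  have hfr : ∀ x ∈ frontier Ω, CT μ x = 0 := by
    intro x hx
    obtain ⟨h1, h2⟩ := frontier_Uc p hdeg hx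
    exact v_zero_julia p hμ.CT_cont hCb hv h1 h2
  have hann : ∀ z ∈ Ω, z ∉ Metric.closedBall a r → CT μ z = 0 := by
    intro z hz hza
    refine v_zero_annulus hΩb hr hμ.CT_cont hCb hfr ?_ hz hza
    intro y hy hya
    refine hμ.CT_diff ?_
    filter_upwards [hΩ.mem_nhds hy, Metric.isClosed_closedBall.isOpen_compl.mem_nhds hya] with w h1 h2
    exact hoffμ w h1 fun h => h2 (Metric.ball_subset_closedBall h)
  have hA0 : ∀ z, z ∉ Metric.closedBall a r → CT ((Metric.ball a r).indicator μ) z = 0 :=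
    fun z hz => A_zero hμ hΩ hrΩ hoffμ hann hz
  have hν := hμ.indicator (S := Metric.ball a r) Metric.isOpen_ball.measurableSet
  refine coeffs_vanish (a := a) c hr hν ?_ ?_ ?_
  · intro w hw
    rw [Set.indicator_of_mem hw]
    simp only [hμdef]
    refine Finset.sum_congr rfl fun k _ => ?_
    rw [hon k w hw]
  · intro w hw; exact Set.indicator_of_notMem hw _
  · intro j
    obtain ⟨⟨M', h⟩, -⟩ := moments hν hA0 j
    exact ⟨h.integrable0, moments_zero hν hA0 j⟩

end NWD

/-- Sullivan's no wandering domains theorem for polynomials: every connected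
component of the interior of the filled Julia set of a polynomial of degree at
least 2 is eventually periodic. -/
theorem no_wandering_components_of_filled_julia_interior
    (p : Polynomial ℂ) (hdeg : 2 ≤ p.natDegree) :
    ∀ z ∈ interior {w : ℂ |
        Bornology.IsBounded (Set.range fun n : ℕ => (fun u : ℂ => p.eval u)^[n] w)},
      ∃ n m : ℕ, n < m ∧
        (fun u : ℂ => p.eval u)^[m] z ∈
          connectedComponentIn
            (interior {w : ℂ |
              Bornology.IsBounded (Set.range fun n : ℕ => (fun u : ℂ => p.eval u)^[n] w)})
            ((fun u : ℂ => p.eval u)^[n] z) := by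
  intro z hz
  by_contra hcon
  push Not at hcon
  obtain ⟨z0, hz0, hinj, hder, hdis⟩ := NWD.wander_setup p hdeg (z := z) hz hcon
  exact NWD.core p hdeg hz0 hinj hder hdis
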